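/- arXiv:0707.2439 — 3 statements merged into one kernel-verified Lean document; each statement's English description precedes it below -/
import Mathlib

section
/- For n ≥ 4, set e = x² ∈ M_n. Then for every idempotent f ≠ 1 of M_n there exists a unit g of M_n such that g⁻¹ f g lies in the local submonoid e M_n e, i.e. e (g⁻¹ f g) e = g⁻¹ f g. -/
/-! Words over the alphabet `{x, s₁, …, s_{n-1}}` of the presentation of the dual
symmetric inverse monoid, encoded as `FreeMonoid (Fin n)` with letter `0 = x` and
letter `i = sᵢ` for `1 ≤ i ≤ n - 1`. -/

/-- The letter `x`. -/
def xw (n : ℕ) : FreeMonoid (Fin n) :=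
  if h : 0 < n then FreeMonoid.of ⟨0, h⟩ else 1

/-- The letter `sᵢ` (for `1 ≤ i ≤ n - 1`; junk value `1` otherwise). -/
def sw (n : ℕ) (i : ℕ) : FreeMonoid (Fin n) :=
  if h : i < n then FreeMonoid.of ⟨i, h⟩ else 1

/-- The word `σ = s₂ s₃ s₁ s₂`. -/
def σw (n : ℕ) : FreeMonoid (Fin n) := sw n 2 * sw n 3 * sw n 1 * sw n 2

/-- The exponent `m_{ij}`: `1` if `i = j`, `3` if `|i - j| = 1`, and `2` if
`|i - j| > 1`. -/
def mExp (i j : ℕ) : ℕ :=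
  if i = j then 1 else if j - i = 1 ∨ i - j = 1 then 3 else 2

/-- The words `l₂ = x s₂ s₁` and `l_{i+1} = s_{i+1} lᵢ s_{i+1} sᵢ` (junk value `1`
for `i < 2`). -/
def lw (n : ℕ) : ℕ → FreeMonoid (Fin n)
  | 0 => 1
  | 1 => 1
  | 2 => xw n * sw n 2 * sw n 1
  | (i + 3) => sw n (i + 3) * lw n (i + 2) * sw n (i + 3) * sw n (i + 2)

/-- The words `y₃ = x` and `y_{i+1} = lᵢ yᵢ sᵢ` (junk value `1` for `i < 3`). -/
def yw (n : ℕ) : ℕ → FreeMonoid (Fin n)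
  | 0 => 1
  | 1 => 1
  | 2 => 1
  | 3 => xw n
  | (i + 4) => lw n (i + 3) * yw n (i + 3) * sw n (i + 3)

/-- The defining relations (R1)–(R7) of the monoid `Mₙ`.  Any relation involving a
generator `sᵢ` with `i > n - 1` is omitted (this is the role of the hypotheses
bounding the indices, and of `4 ≤ n` in (R5), which involves `s₃`). -/
inductive MRel (n : ℕ) : FreeMonoid (Fin n) → FreeMonoid (Fin n) → Prop
  | r1 {i j : ℕ} : 1 ≤ i → i ≤ j → j ≤ n - 1 →
      MRel n ((sw n i * sw n j) ^ mExp i j) 1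
  | r2 : MRel n (xw n ^ 3) (xw n)
  | r3a : MRel n (xw n * sw n 1) (xw n)
  | r3b : MRel n (sw n 1 * xw n) (xw n)
  | r4a : MRel n (xw n * sw n 2 * xw n) (xw n * sw n 2 * xw n * sw n 2)
  | r4b : MRel n (xw n * sw n 2 * xw n) (sw n 2 * xw n * sw n 2 * xw n)
  | r4c : MRel n (xw n * sw n 2 * xw n) (xw n * sw n 2 * xw n ^ 2)
  | r4d : MRel n (xw n * sw n 2 * xw n) (xw n ^ 2 * sw n 2 * xw n)
  | r5a : 4 ≤ n →
      MRel n (xw n ^ 2 * σw n * xw n ^ 2 * σw n) (σw n * xw n ^ 2 * σw n * xw n ^ 2)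
  | r5b : 4 ≤ n →
      MRel n (xw n ^ 2 * σw n * xw n ^ 2 * σw n) (xw n * sw n 2 * sw n 3 * sw n 2 * xw n)
  | r6 {i : ℕ} : 3 ≤ i → i ≤ n - 1 →
      MRel n (yw n i * sw n i * yw n i) (sw n i * yw n i * sw n i)
  | r7 {i : ℕ} : 4 ≤ i → i ≤ n - 1 →
      MRel n (xw n * sw n i) (sw n i * xw n)

/-- The monoid congruence generated by the relations (R1)–(R7). -/
def Mcon (n : ℕ) : Con (FreeMonoid (Fin n)) := conGen (MRel n)

/-- The monoid `Mₙ` presented by generators `x, s₁, …, s_{n-1}` and relations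
(R1)–(R7). -/
abbrev M (n : ℕ) := (Mcon n).Quotient

/-- The generator `x` of `Mₙ`. -/
def xm (n : ℕ) : M n := (Mcon n).mk' (xw n)

/-- The generator `sᵢ` of `Mₙ`. -/
def sm (n : ℕ) (i : ℕ) : M n := (Mcon n).mk' (sw n i)

/-- The element `σ = s₂ s₃ s₁ s₂` of `Mₙ`. -/
def σm (n : ℕ) : M n := (Mcon n).mk' (σw n)

/-- The consequences of (R1)–(R7) that govern the idempotents of `Mₙ`, for elements
`s 1, …, s (n - 1)` and `x` of an arbitrary monoid. -/
structure DualSymmetricRelations {N : Type*} [Monoid N] (n : ℕ) (s : ℕ → N) (x : N) : Prop where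
  four_le : 4 ≤ n
  sq : ∀ k, 1 ≤ k → k < n → s k * s k = 1
  comm : ∀ j k, 1 ≤ j → j + 1 < k → k < n → s j * s k = s k * s j
  braid : ∀ k, 1 ≤ k → k + 1 < n → s k * s (k + 1) * s k = s (k + 1) * s k * s (k + 1)
  x_cube : x * x * x = x
  x_s_one : x * s 1 = x
  s_one_x : s 1 * x = x
  xsx_s : x * s 2 * x = x * s 2 * x * s 2
  s_xsx : x * s 2 * x = s 2 * x * s 2 * x
  xsx_x : x * s 2 * x = x * s 2 * (x * x)
  x_xsx : x * s 2 * x = x * x * s 2 * x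
  sigma_comm : x * x * (s 2 * s 3 * s 1 * s 2) * (x * x) * (s 2 * s 3 * s 1 * s 2) =
    s 2 * s 3 * s 1 * s 2 * (x * x) * (s 2 * s 3 * s 1 * s 2) * (x * x)
  sigma_eq : x * x * (s 2 * s 3 * s 1 * s 2) * (x * x) * (s 2 * s 3 * s 1 * s 2) =
    x * s 2 * s 3 * s 2 * x
  x_braid : x * s 3 * x = s 3 * x * s 3
  x_comm : ∀ k, 4 ≤ k → k < n → x * s k = s k * x

namespace DualSymmetricRelations

section Family

variable {N : Type*} [Monoid N]

/-- Conjugation by the involution `s k`. -/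
def cj (s : ℕ → N) (k : ℕ) (m : N) : N := s k * m * s k

/-- The idempotent merging the points `1` and `d + 2`. -/
def mergeOne (s : ℕ → N) (x : N) : ℕ → N
  | 0 => x * x
  | d + 1 => cj s (d + 2) (mergeOne s x d)

/-- The idempotent merging the points `a + 1` and `d + 2`, for `a ≤ d`. -/
def merge (s : ℕ → N) (x : N) : ℕ → ℕ → N
  | 0, d => mergeOne s x d
  | a + 1, d => cj s (a + 1) (merge s x a d)

/-- The submonoid generated by the idempotents merging two points. -/
def mergeSubmonoid (n : ℕ) (s : ℕ → N) (x : N) : Submonoid N :=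
  Submonoid.closure {c | ∃ a d, a ≤ d ∧ d + 2 ≤ n ∧ c = merge s x a d}


variable {n : ℕ} {s : ℕ → N} {x : N}

theorem cj_cj (h : DualSymmetricRelations n s x) {k : ℕ} (hk : 1 ≤ k) (hkn : k < n) (m : N) :
    cj s k (cj s k m) = m := by
  have := h.sq k hk hkn
  simp only [cj]
  grind

theorem cj_comm (h : DualSymmetricRelations n s x) {j k : ℕ} (hj : 1 ≤ j) (hjk : j + 1 < k)
    (hkn : k < n) (m : N) : cj s j (cj s k m) = cj s k (cj s j m) := by
  have := h.comm j k hj hjk hkn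
  simp only [cj]
  grind

theorem cj_braid (h : DualSymmetricRelations n s x) {k : ℕ} (hk : 1 ≤ k) (hkn : k + 1 < n)
    (m : N) :
    cj s k (cj s (k + 1) (cj s k m)) = cj s (k + 1) (cj s k (cj s (k + 1) m)) := by
  have := h.braid k hk hkn
  simp only [cj]
  grind

theorem cj_mul (h : DualSymmetricRelations n s x) {k : ℕ} (hk : 1 ≤ k) (hkn : k < n) (a b : N) :
    cj s k (a * b) = cj s k a * cj s k b := by
  have := h.sq k hk hkn
  simp only [cj]
  grind

theorem cj_one (h : DualSymmetricRelations n s x) {k : ℕ} (hk : 1 ≤ k) (hkn : k < n) :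
    cj s k 1 = 1 := by
  simp [cj, h.sq k hk hkn]

theorem cj_one_sq_x (h : DualSymmetricRelations n s x) : cj s 1 (x * x) = x * x := by
  have := h.x_s_one
  have := h.s_one_x
  simp only [cj]
  grind

theorem s_three_x_s_three_x (h : DualSymmetricRelations n s x) :
    s 3 * x * s 3 * x = x * s 3 := by
  have := h.four_le
  have := h.sq 3 (by omega) (by omega)
  have := h.x_braid
  grind

theorem x_s_three_x_s_three (h : DualSymmetricRelations n s x) :
    x * s 3 * x * s 3 = s 3 * x := by
  have := h.four_le
  have := h.sq 3 (by omega) (by omega)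
  have := h.x_braid
  grind

theorem cj_sq_x (h : DualSymmetricRelations n s x) {k : ℕ} (hk : 3 ≤ k) (hkn : k < n) :
    cj s k (x * x) = x * x := by
  have h1 := h.sq k (by omega) hkn
  simp only [cj]
  obtain rfl | hk := hk.eq_or_lt
  · have h2 := h.s_three_x_s_three_x
    have h3 := h.x_s_three_x_s_three
    have h4 : s 3 * (x * x) = x * x * s 3 := by
      calc s 3 * (x * x) = x * s 3 * x * s 3 * x := by rw [h3, mul_assoc]
        _ = x * (s 3 * x * s 3 * x) := by simp only [mul_assoc]
        _ = x * x * s 3 := by rw [h2, mul_assoc]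
    grind
  · have := h.x_comm k hk hkn
    grind

theorem cj_mergeOne_of_gt (h : DualSymmetricRelations n s x) {d k : ℕ} (hk : d + 3 ≤ k)
    (hkn : k < n) : cj s k (mergeOne s x d) = mergeOne s x d := by
  induction d with
  | zero => exact h.cj_sq_x hk hkn
  | succ d ih =>
    rw [mergeOne, ← h.cj_comm (by omega) (by omega) hkn, ih (by omega)]

theorem cj_mergeOne_of_le (h : DualSymmetricRelations n s x) {d k : ℕ} (hk : 2 ≤ k) (hkd : k ≤ d)
    (hdn : d + 2 ≤ n) : cj s k (mergeOne s x d) = mergeOne s x d := by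
  induction d with
  | zero => omega
  | succ d ih =>
    obtain rfl | hlt := hkd.eq_or_lt
    · obtain ⟨d, rfl⟩ : ∃ c, d = c + 1 := ⟨d - 1, by omega⟩
      simp only [mergeOne]
      rw [h.cj_braid (by omega) (by omega), h.cj_mergeOne_of_gt (by omega) (by omega)]
    · rw [mergeOne, h.cj_comm (by omega) (by omega) (by omega), ih (by omega) (by omega)]

theorem cj_merge_of_gt (h : DualSymmetricRelations n s x) {a d k : ℕ} (had : a ≤ d)
    (hk : d + 3 ≤ k) (hkn : k < n) : cj s k (merge s x a d) = merge s x a d := by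
  induction a with
  | zero => exact h.cj_mergeOne_of_gt hk hkn
  | succ a ih =>
    rw [merge, ← h.cj_comm (by omega) (by omega) hkn, ih (by omega)]

theorem cj_merge_add_two (h : DualSymmetricRelations n s x) {a d : ℕ} (had : a ≤ d)
    (hdn : d + 2 < n) : cj s (d + 2) (merge s x a d) = merge s x a (d + 1) := by
  induction a with
  | zero => rfl
  | succ a ih =>
    rw [merge, ← h.cj_comm (by omega) (by omega) hdn, ih (by omega), merge]

theorem cj_merge_of_between (h : DualSymmetricRelations n s x) {a d k : ℕ} (hak : a + 2 ≤ k)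
    (hkd : k ≤ d) (hdn : d + 2 ≤ n) : cj s k (merge s x a d) = merge s x a d := by
  induction a with
  | zero => exact h.cj_mergeOne_of_le hak hkd hdn
  | succ a ih =>
    rw [merge, ← h.cj_comm (by omega) (by omega) (by omega), ih (by omega)]

theorem cj_merge_of_lt (h : DualSymmetricRelations n s x) {a d k : ℕ} (hk : 1 ≤ k) (hka : k < a)
    (had : a ≤ d) (hdn : d + 2 ≤ n) : cj s k (merge s x a d) = merge s x a d := by
  induction a with
  | zero => omega
  | succ a ih =>
    obtain rfl | hlt := (Nat.lt_succ_iff.mp hka).eq_or_lt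
    · obtain ⟨b, rfl⟩ : ∃ b, k = b + 1 := ⟨k - 1, by omega⟩
      simp only [merge]
      rw [h.cj_braid (by omega) (by omega), h.cj_merge_of_between (by omega) (by omega) hdn]
    · rw [merge, h.cj_comm hk (by omega) (by omega), ih hlt (by omega)]

theorem cj_merge_self (h : DualSymmetricRelations n s x) {d : ℕ} (hdn : d + 2 ≤ n) :
    cj s (d + 1) (merge s x d d) = merge s x d d := by
  induction d with
  | zero => exact h.cj_one_sq_x
  | succ d ih =>
    rw [merge, ← h.cj_merge_add_two le_rfl (by omega), ← h.cj_braid (by omega) (by omega),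
      ih (by omega)]

theorem cj_merge_mem (h : DualSymmetricRelations n s x) {a d k : ℕ} (had : a ≤ d)
    (hdn : d + 2 ≤ n) (hk : 1 ≤ k) (hkn : k < n) :
    ∃ b c, b ≤ c ∧ c + 2 ≤ n ∧ cj s k (merge s x a d) = merge s x b c := by
  rcases lt_or_ge k a with h1 | h1
  · exact ⟨a, d, had, hdn, h.cj_merge_of_lt hk h1 had hdn⟩
  rcases h1.eq_or_lt with rfl | h1
  · obtain ⟨a, rfl⟩ : ∃ b, a = b + 1 := ⟨a - 1, by omega⟩
    exact ⟨a, d, by omega, hdn, by rw [merge, h.cj_cj hk hkn]⟩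
  rcases (Nat.succ_le_of_lt h1).eq_or_lt with rfl | h1
  · rcases had.eq_or_lt with rfl | had
    · exact ⟨a, a, le_rfl, hdn, h.cj_merge_self hdn⟩
    · exact ⟨a + 1, d, had, hdn, rfl⟩
  rcases le_or_gt k d with h2 | h2
  · exact ⟨a, d, had, hdn, h.cj_merge_of_between h1 h2 hdn⟩
  rcases (Nat.succ_le_of_lt h2).eq_or_lt with rfl | h2
  · obtain ⟨d, rfl⟩ : ∃ b, d = b + 1 := ⟨d - 1, by omega⟩
    refine ⟨a, d, by omega, by omega, ?_⟩
    rw [← h.cj_merge_add_two (by omega) (by omega), h.cj_cj (by omega) (by omega)]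
  rcases (Nat.succ_le_of_lt h2).eq_or_lt with rfl | h2
  · exact ⟨a, d + 1, by omega, by omega, h.cj_merge_add_two had hkn⟩
  · exact ⟨a, d, had, hdn, h.cj_merge_of_gt had h2 hkn⟩

/-- An induction principle: every merging idempotent arises from `merge 0 0 = x²` by conjugation. -/
theorem merge_induction {P : N → Prop} (hx : P (x * x))
    (hs : ∀ k c, 1 ≤ k → k < n → P c → P (cj s k c)) {a d : ℕ} (had : a ≤ d)
    (hdn : d + 2 ≤ n) : P (merge s x a d) := by
  induction a with
  | zero =>
    induction d with
    | zero => exact hx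
    | succ d ih => exact hs _ _ (by omega) (by omega) (ih (by omega) (by omega))
  | succ a ih => exact hs _ _ (by omega) (by omega) (ih (by omega))

theorem merge_mem {a d : ℕ} (had : a ≤ d) (hdn : d + 2 ≤ n) :
    merge s x a d ∈ mergeSubmonoid n s x :=
  Submonoid.subset_closure ⟨a, d, had, hdn, rfl⟩

theorem x_sq_idem (h : DualSymmetricRelations n s x) : x * x * (x * x) = x * x := by
  have := h.x_cube
  grind

theorem merge_idem (h : DualSymmetricRelations n s x) {a d : ℕ} (had : a ≤ d) (hdn : d + 2 ≤ n) :
    IsIdempotentElem (merge s x a d) := by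
  refine merge_induction (P := IsIdempotentElem) h.x_sq_idem (fun k c hk hkn hc => ?_) had hdn
  rw [IsIdempotentElem, ← h.cj_mul hk hkn, hc.eq]

theorem commute_cj (h : DualSymmetricRelations n s x) {k : ℕ} (hk : 1 ≤ k) (hkn : k < n) {a b : N}
    (hab : Commute a b) : Commute (cj s k a) (cj s k b) := by
  rw [Commute, SemiconjBy, ← h.cj_mul hk hkn, hab.eq, h.cj_mul hk hkn]

/-- The element `x s₂ x` merges the points `1`, `2` and `3`. -/
theorem sq_mul_mergeOne (h : DualSymmetricRelations n s x) :
    x * x * mergeOne s x 1 = x * s 2 * x := by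
  have h1 := h.xsx_s
  have h2 := h.xsx_x
  have h3 := h.x_xsx
  simp only [mergeOne, cj]
  calc x * x * (s 2 * (x * x) * s 2) = x * x * s 2 * x * x * s 2 := by simp only [mul_assoc]
    _ = x * s 2 * (x * x) * s 2 := by rw [← h3]; simp only [mul_assoc]
    _ = _ := by rw [← h2, ← h1]

theorem mergeOne_mul_sq (h : DualSymmetricRelations n s x) :
    mergeOne s x 1 * (x * x) = x * s 2 * x := by
  have h1 := h.s_xsx
  have h2 := h.xsx_x
  have h3 := h.x_xsx
  simp only [mergeOne, cj]
  calc s 2 * (x * x) * s 2 * (x * x) = s 2 * x * (x * s 2 * (x * x)) := by simp only [mul_assoc]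
    _ = s 2 * (x * x * s 2 * x) := by rw [← h2]; simp only [mul_assoc]
    _ = s 2 * x * s 2 * x := by rw [← h3]; simp only [mul_assoc]
    _ = _ := by rw [← h1]

theorem merge_two_two (h : DualSymmetricRelations n s x) :
    merge s x 2 2 = s 2 * s 3 * s 1 * s 2 * (x * x) * (s 2 * s 3 * s 1 * s 2) := by
  have := h.four_le
  have := h.comm 1 3 le_rfl (by omega) (by omega)
  simp only [merge, mergeOne, cj]
  grind

theorem commute_sq_x_merge (h : DualSymmetricRelations n s x) {a d : ℕ} (had : a ≤ d)
    (hdn : d + 2 ≤ n) : Commute (x * x) (merge s x a d) := by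
  have h4 := h.four_le
  have step : ∀ {k : ℕ} {c : N}, 3 ≤ k → k < n → Commute (x * x) c →
      Commute (x * x) (cj s k c) := fun {k c} hk hkn hc => by
    have := h.commute_cj (by omega) hkn hc
    rwa [h.cj_sq_x hk hkn] at this
  have zero_merge : Commute (x * x) (merge s x 0 d) := by
    clear had
    induction d with
    | zero => exact Commute.refl _
    | succ d ih =>
      obtain rfl | hd := Nat.eq_zero_or_pos d
      · exact h.sq_mul_mergeOne.trans h.mergeOne_mul_sq.symm
      · exact step (by omega) (by omega) (ih (by omega))
  match a with
  | 0 => exact zero_merge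
  | 1 =>
    have := h.commute_cj le_rfl (by omega) zero_merge
    rwa [h.cj_one_sq_x] at this
  | a + 2 =>
    induction a with
    | zero =>
      clear zero_merge
      induction d, had using Nat.le_induction with
      | base =>
        have := h.sigma_comm
        rw [h.merge_two_two, Commute, SemiconjBy]
        simpa only [mul_assoc] using this
      | succ d hd ih =>
        rw [← h.cj_merge_add_two hd (by omega)]
        exact step (by omega) (by omega) (ih (by omega))
    | succ a ih => exact step (by omega) (by omega) (ih (by omega))

theorem commute_merge_merge (h : DualSymmetricRelations n s x) {a d b c : ℕ} (had : a ≤ d)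
    (hdn : d + 2 ≤ n) (hbc : b ≤ c) (hcn : c + 2 ≤ n) :
    Commute (merge s x a d) (merge s x b c) := by
  refine merge_induction
    (P := fun m => ∀ b c, b ≤ c → c + 2 ≤ n → Commute m (merge s x b c))
    (fun b c hbc hcn => h.commute_sq_x_merge hbc hcn)
    (fun k m hk hkn hm b c hbc hcn => ?_) had hdn b c hbc hcn
  obtain ⟨b', c', hbc', hcn', heq⟩ := h.cj_merge_mem hbc hcn hk hkn
  have := h.commute_cj hk hkn (hm b' c' hbc' hcn')
  rwa [← heq, h.cj_cj hk hkn] at this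

theorem commute_of_mem (h : DualSymmetricRelations n s x) {p q : N}
    (hp : p ∈ mergeSubmonoid n s x) (hq : q ∈ mergeSubmonoid n s x) : Commute p q := by
  refine Submonoid.closure_induction₂ (motive := fun p q _ _ => Commute p q) ?_
    (fun p _ => Commute.one_left p) (fun p _ => Commute.one_right p)
    (fun _ _ _ _ _ _ => Commute.mul_left) (fun _ _ _ _ _ _ => Commute.mul_right) hp hq
  rintro _ _ ⟨a, d, had, hdn, rfl⟩ ⟨b, c, hbc, hcn, rfl⟩
  exact h.commute_merge_merge had hdn hbc hcn

theorem idem_of_mem (h : DualSymmetricRelations n s x) {p : N}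
    (hp : p ∈ mergeSubmonoid n s x) : IsIdempotentElem p := by
  induction hp using Submonoid.closure_induction with
  | mem p hp =>
    obtain ⟨a, d, had, hdn, rfl⟩ := hp
    exact h.merge_idem had hdn
  | one => exact IsIdempotentElem.one
  | mul p q hp hq ihp ihq => exact ihp.mul_of_commute (h.commute_of_mem hp hq) ihq

theorem cj_mem (h : DualSymmetricRelations n s x) {k : ℕ} (hk : 1 ≤ k) (hkn : k < n) {p : N}
    (hp : p ∈ mergeSubmonoid n s x) : cj s k p ∈ mergeSubmonoid n s x := by
  induction hp using Submonoid.closure_induction with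
  | mem p hp =>
    obtain ⟨a, d, had, hdn, rfl⟩ := hp
    obtain ⟨b, c, hbc, hcn, heq⟩ := h.cj_merge_mem had hdn hk hkn
    exact heq ▸ merge_mem hbc hcn
  | one => exact by rw [h.cj_one hk hkn]; exact one_mem _
  | mul p q _ _ ihp ihq => rw [h.cj_mul hk hkn]; exact mul_mem ihp ihq

theorem x_mul_mergeOne_one (h : DualSymmetricRelations n s x) :
    x * mergeOne s x 1 = x * x * mergeOne s x 1 * x := by
  have h1 := h.xsx_s
  have h2 := h.xsx_x
  rw [h.sq_mul_mergeOne]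
  simp only [mergeOne, cj]
  calc x * (s 2 * (x * x) * s 2) = x * s 2 * (x * x) * s 2 := by simp only [mul_assoc]
    _ = x * s 2 * (x * x) := by rw [← h2, ← h1]
    _ = _ := by simp only [mul_assoc]

theorem x_mul_merge_two_two_mul_x (h : DualSymmetricRelations n s x) :
    x * merge s x 2 2 * x = x * x * mergeOne s x 2 := by
  have h4 := h.four_le
  have hb := h.braid 2 (by omega) (by omega)
  have hxs := h.s_three_x_s_three_x
  have hsx := h.x_s_three_x_s_three
  have he : x * x * merge s x 2 2 = x * s 2 * s 3 * s 2 * x := by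
    rw [h.merge_two_two, ← h.sigma_eq]
    simp only [mul_assoc]
  have hmerge : x * x * mergeOne s x 2 = s 3 * (x * s 2 * x) * s 3 := by
    rw [← h.sq_mul_mergeOne]
    change _ = cj s 3 _
    rw [h.cj_mul (by omega) (by omega), h.cj_sq_x le_rfl (by omega)]
    rfl
  have hz : x * (x * s 2 * x) * x = x * s 2 * x := by
    calc x * (x * s 2 * x) * x = x * x * s 2 * x * x := by simp only [mul_assoc]
      _ = x * s 2 * (x * x) := by rw [← h.x_xsx]; simp only [mul_assoc]
      _ = x * s 2 * x := h.xsx_x.symm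
  calc x * merge s x 2 2 * x = x * (x * x * merge s x 2 2) * x := by
        rw [← mul_assoc, ← mul_assoc, h.x_cube]
    _ = x * x * (s 2 * s 3 * s 2) * x * x := by rw [he]; simp only [mul_assoc]
    _ = x * (x * s 3) * s 2 * (s 3 * x) * x := by rw [hb]; simp only [mul_assoc]
    _ = x * (s 3 * x * s 3 * x) * s 2 * (x * s 3 * x * s 3) * x := by rw [hxs, hsx]
    _ = x * s 3 * x * s 3 * (x * s 2 * x) * (s 3 * x * s 3 * x) := by simp only [mul_assoc]
    _ = s 3 * (x * (x * s 2 * x) * x) * s 3 := by rw [hxs, hsx]; simp only [mul_assoc]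
    _ = x * x * mergeOne s x 2 := by rw [hz, hmerge]

theorem x_mul_merge_two_two (h : DualSymmetricRelations n s x) :
    x * merge s x 2 2 = x * x * mergeOne s x 2 * x := by
  have h4 := h.four_le
  have hcomm := (h.commute_sq_x_merge (a := 2) (d := 2) le_rfl (by omega)).eq
  rw [← h.x_mul_merge_two_two_mul_x]
  calc x * merge s x 2 2 = x * (x * x * merge s x 2 2) := by
        rw [← mul_assoc, ← mul_assoc, h.x_cube]
    _ = _ := by rw [hcomm]; simp only [mul_assoc]

theorem x_mul_mergeOne_two (h : DualSymmetricRelations n s x) :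
    x * mergeOne s x 2 = merge s x 2 2 * x := by
  have h4 := h.four_le
  have hcomm := (h.commute_sq_x_merge (a := 2) (d := 2) le_rfl (by omega)).eq
  calc x * mergeOne s x 2 = x * (x * x * mergeOne s x 2) := by
        rw [← mul_assoc, ← mul_assoc, h.x_cube]
    _ = x * x * merge s x 2 2 * x := by
        rw [← h.x_mul_merge_two_two_mul_x]; simp only [mul_assoc]
    _ = merge s x 2 2 * x := by rw [hcomm, mul_assoc, h.x_cube]

theorem x_mul_merge_three_three (h : DualSymmetricRelations n s x) (hn : 5 ≤ n) :
    x * merge s x 3 3 = merge s x 3 3 * x := by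
  have hss : ∀ m, s 3 * (s 3 * m) = m := fun m => by
    rw [← mul_assoc, h.sq 3 (by omega) (by omega), one_mul]
  have hxxx : ∀ m, x * (x * (x * m)) = x * m := fun m => by
    simp only [← mul_assoc, h.x_cube]
  have hx4 := h.x_comm 4 le_rfl (by omega)
  have hx4m : ∀ m, x * (s 4 * m) = s 4 * (x * m) := fun m => by
    rw [← mul_assoc, hx4, mul_assoc]
  have e45 : merge s x 3 3 = s 3 * merge s x 2 3 * s 3 := rfl
  have e35 : merge s x 2 3 = s 4 * merge s x 2 2 * s 4 :=
    (h.cj_merge_add_two (a := 2) (d := 2) le_rfl (by omega)).symm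
  have e15 : mergeOne s x 3 = s 4 * mergeOne s x 2 * s 4 := rfl
  have hfix : s 3 * mergeOne s x 3 * s 3 = mergeOne s x 3 :=
    h.cj_mergeOne_of_le (by omega) le_rfl (by omega)
  have h35 : x * merge s x 2 3 = x * x * mergeOne s x 3 * x := by
    calc x * merge s x 2 3 = s 4 * (x * merge s x 2 2) * s 4 := by
          simp only [e35, mul_assoc, hx4m]
      _ = x * x * mergeOne s x 3 * x := by
          simp only [h.x_mul_merge_two_two, e15, mul_assoc, hx4, hx4m]
  have h15 : x * mergeOne s x 3 = merge s x 2 3 * x := by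
    calc x * mergeOne s x 3 = s 4 * (x * mergeOne s x 2) * s 4 := by
          simp only [e15, mul_assoc, hx4m]
      _ = merge s x 2 3 * x := by
          simp only [h.x_mul_mergeOne_two, e35, mul_assoc, hx4]
  have hcomm : x * x * mergeOne s x 3 = mergeOne s x 3 * (x * x) :=
    (h.commute_sq_x_merge (a := 0) (d := 3) (by omega) (by omega)).eq
  calc x * merge s x 3 3 = s 3 * x * s 3 * x * merge s x 2 3 * s 3 := by
        rw [e45, h.s_three_x_s_three_x]; simp only [mul_assoc]
    _ = s 3 * x * s 3 * (mergeOne s x 3 * (x * x) * x) * s 3 := by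
        rw [← hcomm, ← h35]; simp only [mul_assoc]
    _ = s 3 * (x * (s 3 * mergeOne s x 3 * s 3)) * s 3 * x * s 3 := by
        simp only [mul_assoc, hss, hxxx]
    _ = s 3 * merge s x 2 3 * (x * s 3 * x * s 3) := by
        rw [hfix, h15]; simp only [mul_assoc]
    _ = merge s x 3 3 * x := by
        rw [e45, h.x_s_three_x_s_three]; simp only [mul_assoc]

/-- Merging idempotents can be moved across `x` from right to left. -/
theorem exists_x_mul_merge (h : DualSymmetricRelations n s x) {a d : ℕ} (had : a ≤ d)
    (hdn : d + 2 ≤ n) : ∃ q ∈ mergeSubmonoid n s x, x * merge s x a d = q * x := by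
  have h4 := h.four_le
  have step : ∀ {k : ℕ} {c : N}, 4 ≤ k → k < n →
      (∃ q ∈ mergeSubmonoid n s x, x * c = q * x) →
      ∃ q ∈ mergeSubmonoid n s x, x * cj s k c = q * x := by
    rintro k c hk hkn ⟨q, hq, hqx⟩
    refine ⟨cj s k q, h.cj_mem (by omega) hkn hq, ?_⟩
    have hxk := h.x_comm k hk hkn
    calc x * cj s k c = s k * (x * c) * s k := by
          simp only [cj, ← mul_assoc, hxk]
      _ = cj s k q * x := by simp only [hqx, cj, mul_assoc, hxk]
  have hxx : x * x ∈ mergeSubmonoid n s x := merge_mem (a := 0) (d := 0) le_rfl (by omega)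
  have zero_merge : ∃ q ∈ mergeSubmonoid n s x, x * merge s x 0 d = q * x := by
    clear had
    induction d with
    | zero => exact ⟨x * x, hxx, (mul_assoc x x x).symm⟩
    | succ d ih =>
      match d with
      | 0 => exact ⟨_, mul_mem hxx (merge_mem (a := 0) (d := 1) (by omega) (by omega)),
          h.x_mul_mergeOne_one⟩
      | 1 => exact ⟨_, merge_mem (a := 2) (d := 2) le_rfl (by omega), h.x_mul_mergeOne_two⟩
      | d + 2 => exact step (by omega) (by omega) (ih (by omega))
  match a with
  | 0 => exact zero_merge
  | 1 =>
    obtain ⟨q, hq, hqx⟩ := zero_merge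
    refine ⟨q, hq, ?_⟩
    calc x * merge s x 1 d = x * s 1 * merge s x 0 d * s 1 := by simp only [merge, cj, mul_assoc]
      _ = q * x := by rw [h.x_s_one, hqx, mul_assoc, h.x_s_one]
  | 2 =>
    clear zero_merge
    induction d, had using Nat.le_induction with
    | base => exact ⟨_, mul_mem hxx (merge_mem (a := 0) (d := 2) (by omega) (by omega)),
        h.x_mul_merge_two_two⟩
    | succ d hd ih =>
      rw [← h.cj_merge_add_two hd (by omega)]
      exact step (by omega) (by omega) (ih (by omega))
  | a + 3 =>
    induction a with
    | zero =>
      clear zero_merge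
      induction d, had using Nat.le_induction with
      | base => exact ⟨_, merge_mem le_rfl hdn, h.x_mul_merge_three_three hdn⟩
      | succ d hd ih =>
        rw [← h.cj_merge_add_two hd (by omega)]
        exact step (by omega) (by omega) (ih (by omega))
    | succ a ih => exact step (by omega) (by omega) (ih (by omega))

theorem exists_x_mul (h : DualSymmetricRelations n s x) {p : N}
    (hp : p ∈ mergeSubmonoid n s x) : ∃ q ∈ mergeSubmonoid n s x, x * p = q * x := by
  induction hp using Submonoid.closure_induction with
  | mem p hp =>
    obtain ⟨a, d, had, hdn, rfl⟩ := hp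
    exact h.exists_x_mul_merge had hdn
  | one => exact ⟨1, one_mem _, by simp⟩
  | mul p q _ _ ihp ihq =>
    obtain ⟨p', hp', hpx⟩ := ihp
    obtain ⟨q', hq', hqx⟩ := ihq
    exact ⟨p' * q', mul_mem hp' hq', by rw [← mul_assoc, hpx, mul_assoc, hqx, mul_assoc]⟩

theorem x_mul_mul_x_mem (h : DualSymmetricRelations n s x) {p : N}
    (hp : p ∈ mergeSubmonoid n s x) : x * p * x ∈ mergeSubmonoid n s x := by
  have h4 := h.four_le
  obtain ⟨q, hq, hqx⟩ := h.exists_x_mul hp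
  rw [hqx, mul_assoc]
  exact mul_mem hq (merge_mem (a := 0) (d := 0) le_rfl (by omega))

/-- `m` and `m'` are mutually inverse and conjugation by them preserves the submonoid generated by
the merging idempotents. -/
structure NormalInverse (n : ℕ) (s : ℕ → N) (x m m' : N) : Prop where
  mul_mul : m * m' * m = m
  mul_mul' : m' * m * m' = m'
  conj_mem : ∀ p ∈ mergeSubmonoid n s x, m * p * m' ∈ mergeSubmonoid n s x
  conj_mem' : ∀ p ∈ mergeSubmonoid n s x, m' * p * m ∈ mergeSubmonoid n s x

theorem NormalInverse.mul (h : DualSymmetricRelations n s x) {a a' b b' : N}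
    (ha : NormalInverse n s x a a') (hb : NormalInverse n s x b b') :
    NormalInverse n s x (a * b) (b' * a') := by
  have hbb := hb.conj_mem 1 (one_mem _)
  have haa := ha.conj_mem' 1 (one_mem _)
  rw [mul_one] at hbb haa
  have hcomm := (h.commute_of_mem hbb haa).eq
  refine ⟨?_, ?_, fun p hp => ?_, fun p hp => ?_⟩
  · calc a * b * (b' * a') * (a * b) = a * (b * b' * (a' * a)) * b := by simp only [mul_assoc]
      _ = a * a' * a * (b * b' * b) := by rw [hcomm]; simp only [mul_assoc]
      _ = a * b := by rw [ha.mul_mul, hb.mul_mul]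
  · calc b' * a' * (a * b) * (b' * a') = b' * (a' * a * (b * b')) * a' := by
          simp only [mul_assoc]
      _ = b' * b * b' * (a' * a * a') := by rw [← hcomm]; simp only [mul_assoc]
      _ = b' * a' := by rw [ha.mul_mul', hb.mul_mul']
  · simpa only [mul_assoc] using ha.conj_mem _ (hb.conj_mem p hp)
  · simpa only [mul_assoc] using hb.conj_mem' _ (ha.conj_mem' p hp)

theorem NormalInverse.mem_of_idem (h : DualSymmetricRelations n s x) {f f' : N}
    (hf : NormalInverse n s x f f') (hff : IsIdempotentElem f) : f ∈ mergeSubmonoid n s x := by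
  have h1 := hf.conj_mem 1 (one_mem _)
  have h2 := hf.conj_mem' 1 (one_mem _)
  rw [mul_one] at h1 h2
  have hmem : f' ∈ mergeSubmonoid n s x := by
    have : f' * f * (f * f') = f' := by
      calc f' * f * (f * f') = f' * (f * f) * f' := by simp only [mul_assoc]
        _ = f' := by rw [hff.eq, hf.mul_mul']
    exact this ▸ mul_mem h2 h1
  have hidem := h.idem_of_mem hmem
  have : f * f' * (f' * f) = f := by
    calc f * f' * (f' * f) = f * (f' * f') * f := by simp only [mul_assoc]
      _ = f := by rw [hidem.eq, hf.mul_mul]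
  exact this ▸ mul_mem h1 h2

theorem normalInverse_x (h : DualSymmetricRelations n s x) : NormalInverse n s x x x :=
  ⟨h.x_cube, h.x_cube, fun _ => h.x_mul_mul_x_mem, fun _ => h.x_mul_mul_x_mem⟩

theorem normalInverse_s (h : DualSymmetricRelations n s x) {k : ℕ} (hk : 1 ≤ k) (hkn : k < n) :
    NormalInverse n s x (s k) (s k) := by
  have := h.sq k hk hkn
  exact ⟨by simp [this], by simp [this], fun _ => h.cj_mem hk hkn, fun _ => h.cj_mem hk hkn⟩

end Family

end DualSymmetricRelations

open DualSymmetricRelations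

theorem mk_eq_of_mRel {n : ℕ} {u v : FreeMonoid (Fin n)} (h : MRel n u v) :
    (Mcon n).mk' u = (Mcon n).mk' v :=
  (Con.eq _).mpr (ConGen.Rel.of _ _ h)

theorem sm_sq {n k : ℕ} (hk : 1 ≤ k) (hkn : k < n) : sm n k * sm n k = 1 := by
  simpa [sm, mExp] using mk_eq_of_mRel (MRel.r1 (n := n) hk le_rfl (by omega))

theorem dualSymmetricRelations_M {n : ℕ} (hn : 4 ≤ n) :
    DualSymmetricRelations n (sm n) (xm n) where
  four_le := hn
  sq _ := sm_sq
  comm j k hj hjk hkn := by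
    have h := mk_eq_of_mRel (MRel.r1 (n := n) hj (show j ≤ k by omega) (by omega))
    have hm : mExp j k = 2 := by
      simp only [mExp]
      rw [if_neg (by omega), if_neg (by omega)]
    rw [hm] at h
    simp only [map_mul, map_one, pow_two] at h
    change sm n j * sm n k * (sm n j * sm n k) = 1 at h
    have hjj := sm_sq hj (show j < n by omega)
    have hkk := sm_sq (show 1 ≤ k by omega) hkn
    calc sm n j * sm n k
        = sm n k * (sm n j * (sm n j * sm n k * (sm n j * sm n k))) := by
          simp only [← mul_assoc]
          rw [mul_assoc (sm n k), hjj, mul_one, hkk, one_mul]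
      _ = sm n k * sm n j := by rw [h, mul_one]
  braid k hk hkn := by
    have h := mk_eq_of_mRel (MRel.r1 (n := n) hk (show k ≤ k + 1 by omega) (by omega))
    have hm : mExp k (k + 1) = 3 := by simp [mExp]
    rw [hm] at h
    simp only [map_mul, map_one, pow_succ, pow_zero, one_mul] at h
    change sm n k * sm n (k + 1) * (sm n k * sm n (k + 1)) * (sm n k * sm n (k + 1)) = 1 at h
    have hkk := sm_sq hk (show k < n by omega)
    have hll := sm_sq (show 1 ≤ k + 1 by omega) hkn
    calc sm n k * sm n (k + 1) * sm n k
        = sm n k * sm n (k + 1) * (sm n k * sm n (k + 1)) * (sm n k * sm n (k + 1)) *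
            (sm n (k + 1) * sm n k * sm n (k + 1)) := by
          simp only [mul_assoc]
          rw [← mul_assoc (sm n (k + 1)) (sm n (k + 1)), hll, one_mul,
            ← mul_assoc (sm n k) (sm n k), hkk, one_mul, hll, mul_one]
      _ = sm n (k + 1) * sm n k * sm n (k + 1) := by rw [h, one_mul]
  x_cube := by simpa [pow_succ, xm] using mk_eq_of_mRel (MRel.r2 (n := n))
  x_s_one := mk_eq_of_mRel MRel.r3a
  s_one_x := mk_eq_of_mRel MRel.r3b
  xsx_s := mk_eq_of_mRel MRel.r4a
  s_xsx := mk_eq_of_mRel MRel.r4b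
  xsx_x := by simpa [pow_two, xm, sm] using mk_eq_of_mRel (MRel.r4c (n := n))
  x_xsx := by simpa [pow_two, xm, sm] using mk_eq_of_mRel (MRel.r4d (n := n))
  sigma_comm := by simpa [pow_two, σw, xm, sm] using mk_eq_of_mRel (MRel.r5a hn)
  sigma_eq := by simpa [pow_two, σw, xm, sm] using mk_eq_of_mRel (MRel.r5b hn)
  x_braid := mk_eq_of_mRel (MRel.r6 le_rfl (by omega))
  x_comm k hk hkn := mk_eq_of_mRel (MRel.r7 hk (by omega))

/-- Induction on words in the generators of `Mₙ`. -/
theorem M_induction {n : ℕ} {P : M n → Prop} (one : P 1) (x_mul : ∀ m, P m → P (xm n * m))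
    (s_mul : ∀ k m, 1 ≤ k → k < n → P m → P (sm n k * m)) (m : M n) : P m := by
  induction m using Con.induction_on with
  | _ w =>
  induction w using FreeMonoid.recOn with
  | one => exact one
  | of_mul i w hw =>
    obtain ⟨i, hi⟩ := i
    obtain rfl | hpos := Nat.eq_zero_or_pos i
    · have : xw n = FreeMonoid.of ⟨0, hi⟩ := dif_pos hi
      have h := x_mul _ hw
      rwa [xm, this] at h
    · have : sw n i = FreeMonoid.of ⟨i, hi⟩ := dif_pos hi
      have h := s_mul i _ hpos hi hw
      rwa [sm, this] at h

theorem commute_of_idem {n : ℕ} (hn : 4 ≤ n) {p q : M n} (hp : IsIdempotentElem p)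
    (hq : IsIdempotentElem q) : Commute p q := by
  have h := dualSymmetricRelations_M hn
  have inverse : ∀ m : M n, ∃ m', NormalInverse n (sm n) (xm n) m m' := by
    refine M_induction ⟨1, by simp, by simp, by simp, by simp⟩ ?_ ?_
    · rintro m ⟨m', hm⟩
      exact ⟨_, NormalInverse.mul h h.normalInverse_x hm⟩
    · rintro k m hk hkn ⟨m', hm⟩
      exact ⟨_, NormalInverse.mul h (h.normalInverse_s hk hkn) hm⟩
  obtain ⟨p', hp'⟩ := inverse p
  obtain ⟨q', hq'⟩ := inverse q
  exact h.commute_of_mem (hp'.mem_of_idem h hp) (hq'.mem_of_idem h hq)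

/-- Every element of `Mₙ` is a unit or factors through `x` after a unit. -/
theorem isUnit_or_exists_eq_unit_mul_x_mul {n : ℕ} (m : M n) :
    IsUnit m ∨ ∃ (g : (M n)ˣ) (m' : M n), m = g * xm n * m' := by
  induction m using M_induction with
  | one => exact Or.inl isUnit_one
  | x_mul m _ => exact Or.inr ⟨1, m, by simp⟩
  | s_mul k m hk hkn hm =>
    let u : (M n)ˣ := ⟨sm n k, sm n k, sm_sq hk hkn, sm_sq hk hkn⟩
    rcases hm with hm | ⟨g, m', rfl⟩
    · exact Or.inl (u.isUnit.mul hm)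
    · exact Or.inr ⟨u * g, m', by simp [u, mul_assoc]⟩

/-- For `n ≥ 4`, with `e = x² ∈ Mₙ`: for every idempotent `f ≠ 1` of
`Mₙ` there exists a unit `g` of `Mₙ` such that `g⁻¹ f g` lies in the local submonoid
`e Mₙ e`, i.e. `e (g⁻¹ f g) e = g⁻¹ f g`. -/
theorem stmt12 (n : ℕ) (hn : 4 ≤ n) (f : M n)
    (hf : IsIdempotentElem f) (hf1 : f ≠ 1) :
    ∃ g : (M n)ˣ,
      (xm n ^ 2) * (↑g⁻¹ * f * ↑g) * (xm n ^ 2) = ↑g⁻¹ * f * ↑g := by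
  have hx := (dualSymmetricRelations_M hn).x_cube
  have hidem := (dualSymmetricRelations_M hn).x_sq_idem
  rcases isUnit_or_exists_eq_unit_mul_x_mul f with hu | ⟨g, m, hm⟩
  · exact absurd (hu.mul_left_cancel (hf.eq.trans (mul_one f).symm)) hf1
  refine ⟨g, ?_⟩
  have hleft : xm n ^ 2 * (↑g⁻¹ * f * ↑g) = ↑g⁻¹ * f * ↑g := by
    rw [hm, pow_two]
    simp only [mul_assoc, Units.inv_mul_cancel_left]
    simp only [← mul_assoc, hx]
  have hconj : IsIdempotentElem (↑g⁻¹ * f * ↑g : M n) := by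
    rw [IsIdempotentElem]
    simp only [mul_assoc, Units.mul_inv_cancel_left]
    rw [← mul_assoc f f, hf.eq]
  have hcomm := commute_of_idem hn (pow_two (xm n) ▸ hidem : IsIdempotentElem (xm n ^ 2)) hconj
  rw [hleft, ← hcomm.eq, hleft]
end

section
/- For n ≥ 4, with e = x² ∈ M_n, σ = s_2 s_3 s_1 s_2, X = s_3 x σ x s_3, S_1 = x, and S_j = x² s_{j+1} for 2 ≤ j ≤ n−2, every element of the local submonoid e M_n e = {m ∈ M_n : e m = m = m e} is a product of elements of {X, S_1, …, S_{n−2}}, the empty product being interpreted as e. -/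
namespace M

variable {n : ℕ}

theorem mk_eq_of_rel {u v : FreeMonoid (Fin n)} (h : MRel n u v) :
    (Mcon n).mk' u = (Mcon n).mk' v :=
  (Con.eq _).2 (ConGen.Rel.of _ _ h)

theorem sm_mul_self {i : ℕ} (h1 : 1 ≤ i) (hn : i < n) : sm n i * sm n i = 1 := by
  have h := mk_eq_of_rel (MRel.r1 h1 le_rfl (by omega : i ≤ n - 1))
  simpa [mExp, sm] using h

theorem sm_mul_sm_mul {i : ℕ} (h1 : 1 ≤ i) (hn : i < n) (a : M n) :
    sm n i * (sm n i * a) = a := by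
  rw [← mul_assoc, sm_mul_self h1 hn, one_mul]

theorem sm_comm {i j : ℕ} (h1 : 1 ≤ i) (hij : i + 2 ≤ j) (hn : j < n) :
    sm n i * sm n j = sm n j * sm n i := by
  have h := mk_eq_of_rel (MRel.r1 h1 (by omega : i ≤ j) (by omega : j ≤ n - 1))
  rw [mExp, if_neg (by omega), if_neg (by omega), map_pow, map_mul, map_one, pow_two] at h
  change sm n i * sm n j * (sm n i * sm n j) = 1 at h
  calc sm n i * sm n j
      = sm n j * (sm n i * (sm n i * sm n j * (sm n i * sm n j))) := by
        rw [mul_assoc (sm n i), sm_mul_sm_mul h1 (by omega), sm_mul_sm_mul (by omega) hn]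
    _ = _ := by rw [h, mul_one]

theorem sm_braid {i : ℕ} (h1 : 1 ≤ i) (hn : i + 1 < n) :
    sm n i * sm n (i + 1) * sm n i = sm n (i + 1) * sm n i * sm n (i + 1) := by
  have h := mk_eq_of_rel (MRel.r1 h1 (by omega : i ≤ i + 1) (by omega : i + 1 ≤ n - 1))
  rw [mExp, if_neg (by omega), if_pos (by omega), map_pow, map_mul, map_one, pow_three] at h
  change sm n i * sm n (i + 1) * (sm n i * sm n (i + 1) * (sm n i * sm n (i + 1))) = 1 at h
  have h' := congrArg (· * (sm n (i + 1) * sm n i * sm n (i + 1))) h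
  simpa [mul_assoc, sm_mul_sm_mul h1 (by omega : i < n), sm_mul_self (by omega : 1 ≤ i + 1) hn,
    sm_mul_sm_mul (by omega : 1 ≤ i + 1) hn] using h'

theorem σm_eq : σm n = sm n 2 * sm n 3 * sm n 1 * sm n 2 := rfl

/-- The idempotent `x²`. -/
def e (n : ℕ) : M n := xm n * xm n

theorem e_eq : xm n ^ 2 = e n := pow_two _

theorem e_mul_xm : e n * xm n = xm n := by
  have h : xm n ^ 3 = xm n := mk_eq_of_rel MRel.r2
  rwa [pow_three, ← mul_assoc] at h

theorem xm_mul_e : xm n * e n = xm n := by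
  rw [e, ← mul_assoc]
  exact e_mul_xm

theorem e_mul_e : e n * e n = e n := by
  nth_rw 1 [e]
  rw [mul_assoc, xm_mul_e, e]

theorem e_mul_sm_one : e n * sm n 1 = e n := by
  have h : xm n * sm n 1 = xm n := mk_eq_of_rel MRel.r3a
  rw [e, mul_assoc, h]

theorem sm_one_mul_e : sm n 1 * e n = e n := by
  have h : sm n 1 * xm n = xm n := mk_eq_of_rel MRel.r3b
  rw [e, ← mul_assoc, h]

theorem sm_mul_e {i : ℕ} (h3 : 3 ≤ i) (hn : i < n) : sm n i * e n = e n * sm n i := by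
  rcases h3.eq_or_lt with rfl | h4
  · have h : xm n * sm n 3 * xm n = sm n 3 * xm n * sm n 3 :=
      mk_eq_of_rel (MRel.r6 le_rfl (by omega))
    have hs := sm_mul_self (n := n) (i := 3) (by omega) hn
    have hl : xm n * sm n 3 * xm n * sm n 3 = sm n 3 * xm n := by
      rw [h, mul_assoc _ (sm n 3), hs, mul_one]
    have hr : sm n 3 * xm n * sm n 3 * xm n = xm n * sm n 3 := by
      simp only [mul_assoc] at h ⊢
      rw [h, ← mul_assoc, hs, one_mul]
    calc sm n 3 * e n = xm n * sm n 3 * xm n * sm n 3 * xm n := by rw [hl, e, mul_assoc]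
      _ = xm n * (sm n 3 * xm n * sm n 3 * xm n) := by simp only [mul_assoc]
      _ = e n * sm n 3 := by rw [hr, e, mul_assoc]
  · have h : xm n * sm n i = sm n i * xm n := mk_eq_of_rel (MRel.r7 h4 (by omega))
    rw [e, ← mul_assoc, ← h, mul_assoc, ← h, mul_assoc]

/-- The submonoid generated by the proposed generators of the local submonoid at `x²`. -/
def localGen (n : ℕ) : Submonoid (M n) :=
  Submonoid.closure {a | a = sm n 3 * xm n * σm n * xm n * sm n 3 ∨ a = xm n ∨
    ∃ j : ℕ, 2 ≤ j ∧ j ≤ n - 2 ∧ a = xm n ^ 2 * sm n (j + 1)}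

theorem xm_mem : xm n ∈ localGen n := Submonoid.subset_closure (Or.inr (Or.inl rfl))

theorem e_mem : e n ∈ localGen n := mul_mem xm_mem xm_mem

theorem e_mul_sm_mem {i : ℕ} (h3 : 3 ≤ i) (hn : i < n) : e n * sm n i ∈ localGen n :=
  Submonoid.subset_closure (Or.inr (Or.inr ⟨i - 1, by omega, by omega, by
    rw [e_eq, Nat.sub_add_cancel (by omega)]⟩))

theorem e_mul_σm_mul_e_mem (hn : 4 ≤ n) : e n * σm n * e n ∈ localGen n := by
  have hX : sm n 3 * xm n * σm n * xm n * sm n 3 ∈ localGen n :=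
    Submonoid.subset_closure (Or.inl rfl)
  have hS : e n * sm n 3 ∈ localGen n := e_mul_sm_mem le_rfl (by omega)
  have hc := sm_mul_e (n := n) (i := 3) le_rfl (by omega)
  have key : e n * σm n * e n =
      xm n * (e n * sm n 3) * (sm n 3 * xm n * σm n * xm n * sm n 3) *
        (e n * sm n 3) * xm n := by
    conv_rhs => rw [← hc]
    simp only [mul_assoc]
    rw [← mul_assoc (sm n 3) (e n), hc]
    simp only [mul_assoc]
    rw [sm_mul_sm_mul (i := 3) (by omega) (by omega), sm_mul_sm_mul (i := 3) (by omega) (by omega),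
      e_mul_xm, ← mul_assoc (xm n) (e n), xm_mul_e, ← mul_assoc (xm n) (xm n)]
    rfl
  rw [key]
  exact mul_mem (mul_mem (mul_mem (mul_mem xm_mem hS) hX) hS) xm_mem

theorem e_mul_sm_two_mul_e_mem (hn : 4 ≤ n) : e n * sm n 2 * e n ∈ localGen n := by
  have hX : sm n 3 * xm n * σm n * xm n * sm n 3 ∈ localGen n :=
    Submonoid.subset_closure (Or.inl rfl)
  have hc := sm_mul_e (n := n) (i := 3) le_rfl (by omega)
  have h5 : e n * σm n * e n * σm n = xm n * sm n 2 * sm n 3 * sm n 2 * xm n := by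
    simp only [← e_eq]
    exact mk_eq_of_rel (MRel.r5b hn)
  have hb : sm n 2 * sm n 3 * sm n 2 = sm n 3 * sm n 2 * sm n 3 := sm_braid (by omega) (by omega)
  have hmid : xm n * σm n * e n * σm n * xm n = sm n 3 * (e n * sm n 2 * e n) * sm n 3 :=
    calc xm n * σm n * e n * σm n * xm n
        = xm n * (e n * σm n * e n * σm n) * xm n := by
          simp only [← mul_assoc, xm_mul_e]
      _ = e n * (sm n 2 * sm n 3 * sm n 2) * e n := by
          rw [h5]
          simp only [e, mul_assoc]
      _ = (e n * sm n 3) * sm n 2 * (sm n 3 * e n) := by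
          rw [hb]
          simp only [mul_assoc]
      _ = sm n 3 * (e n * sm n 2 * e n) * sm n 3 := by
          rw [hc]
          nth_rw 1 [← hc]
          simp only [mul_assoc]
  have key : e n * sm n 2 * e n = (sm n 3 * xm n * σm n * xm n * sm n 3) *
      (sm n 3 * xm n * σm n * xm n * sm n 3) :=
    calc e n * sm n 2 * e n
        = sm n 3 * (sm n 3 * (e n * sm n 2 * e n) * sm n 3) * sm n 3 := by
          rw [mul_assoc (sm n 3) (e n * sm n 2 * e n), sm_mul_sm_mul (by omega) (by omega),
            mul_assoc _ (sm n 3), sm_mul_self (by omega) (by omega), mul_one]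
      _ = _ := by
          rw [← hmid]
          simp only [e, mul_assoc]
          rw [sm_mul_sm_mul (i := 3) (by omega) (by omega)]
  rw [key]
  exact mul_mem hX hX

/-- The product `s_a s_{a+1} ⋯ s_{a+l-1}` of `l` consecutive generators. -/
def seg (n a : ℕ) : ℕ → M n
  | 0 => 1
  | l + 1 => seg n a l * sm n (a + l)

theorem seg_zero (a : ℕ) : seg n a 0 = 1 := rfl

theorem seg_succ (a l : ℕ) : seg n a (l + 1) = seg n a l * sm n (a + l) := rfl

theorem seg_succ' (a l : ℕ) : seg n a (l + 1) = sm n a * seg n (a + 1) l := by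
  induction l with
  | zero => simp [seg]
  | succ l ih =>
    rw [seg_succ, ih, seg_succ, mul_assoc, add_right_comm a 1 l, ← add_assoc]

theorem seg_mul_sm_comm {a l k : ℕ} (ha : 1 ≤ a) (hk : a + l + 1 ≤ k) (hn : k < n) :
    seg n a l * sm n k = sm n k * seg n a l := by
  induction l with
  | zero => simp [seg]
  | succ l ih =>
    rw [seg_succ, mul_assoc, sm_comm (by omega) (by omega) hn, ← mul_assoc, ih (by omega),
      mul_assoc]

theorem sm_mul_seg_comm {a l k : ℕ} (hk : 1 ≤ k) (hka : k + 2 ≤ a) (hn : a + l ≤ n) :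
    sm n k * seg n a l = seg n a l * sm n k := by
  induction l with
  | zero => simp [seg]
  | succ l ih =>
    rw [seg_succ, ← mul_assoc, ih (by omega), mul_assoc, sm_comm hk (by omega) (by omega),
      mul_assoc]

theorem seg_mul_sm_shift {a l k : ℕ} (ha : 1 ≤ a) (hak : a ≤ k) (hk : k + 1 < a + l)
    (hn : a + l ≤ n) : seg n a l * sm n k = sm n (k + 1) * seg n a l := by
  induction l with
  | zero => omega
  | succ l ih =>
    rcases (by omega : k + 1 < a + l ∨ k + 1 = a + l) with h | h
    · rw [seg_succ, mul_assoc, ← sm_comm (by omega : 1 ≤ k) (by omega) (by omega), ← mul_assoc,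
        ih h (by omega), mul_assoc]
    · obtain ⟨l, rfl⟩ : ∃ l', l = l' + 1 := ⟨l - 1, by omega⟩
      obtain rfl : k = a + l := by omega
      rw [seg_succ, seg_succ, ← add_assoc, mul_assoc, mul_assoc, ← mul_assoc (sm n (a + l)),
        sm_braid (by omega) (by omega), mul_assoc, ← mul_assoc (seg n a l),
        seg_mul_sm_comm ha (by omega) (by omega)]
      simp only [mul_assoc]

theorem seg_succ_mul_sm {a l : ℕ} (ha : 1 ≤ a) (hn : a + l < n) :
    seg n a (l + 1) * sm n (a + l) = seg n a l := by
  rw [seg_succ, mul_assoc, sm_mul_self (by omega) hn, mul_one]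

theorem seg_two_mul_seg_one {l q : ℕ} (hl : l ≤ q) (hn : q + 2 ≤ n) :
    seg n 2 l * seg n 1 (q + 1) = seg n 1 (q + 1) * seg n 1 l := by
  induction l with
  | zero => simp [seg]
  | succ l ih =>
    have h := seg_mul_sm_shift (n := n) (a := 1) (l := q + 1) (k := 1 + l) le_rfl (by omega)
      (by omega) (by omega)
    rw [seg_succ, seg_succ 1 l, ← mul_assoc, ← ih (by omega), mul_assoc, mul_assoc, h,
      (by omega : 2 + l = 1 + l + 1)]

theorem seg_mul_e {a l : ℕ} (ha : 3 ≤ a) (hn : a + l ≤ n) :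
    seg n a l * e n = e n * seg n a l := by
  induction l with
  | zero => simp [seg]
  | succ l ih =>
    rw [seg_succ, mul_assoc, sm_mul_e (by omega) (by omega), ← mul_assoc, ih (by omega), mul_assoc]

theorem e_mul_seg_mem {a l : ℕ} (ha : 3 ≤ a) (hn : a + l ≤ n) :
    e n * seg n a l ∈ localGen n := by
  induction l with
  | zero => simpa [seg] using e_mem
  | succ l ih =>
    have h : e n * seg n a (l + 1) = e n * seg n a l * (e n * sm n (a + l)) := by
      rw [mul_assoc, ← mul_assoc (seg n a l), seg_mul_e ha (by omega), mul_assoc,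
        ← mul_assoc (e n) (e n), e_mul_e, seg_succ]
    rw [h]
    exact mul_mem (ih (by omega)) (e_mul_sm_mem (by omega) (by omega))

/-- Minimal-length representatives of the right cosets of `⟨s₁, s₃, …, s_{n-1}⟩` in the
subgroup generated by the `sᵢ`, indexed by `p ≤ q ≤ n - 2`. -/
def cosetRep (n p q : ℕ) : M n := seg n 2 q * seg n 1 p

theorem e_mul_seg_two_mul_e_mem (hn : 4 ≤ n) {q : ℕ} (hq : q + 2 ≤ n) :
    e n * seg n 2 q * e n ∈ localGen n := by
  rcases q with _ | q
  · simpa [seg, e_mul_e] using e_mem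
  · have h : e n * seg n 2 (q + 1) * e n = e n * sm n 2 * e n * (e n * seg n 3 q) := by
      rw [seg_succ', mul_assoc, mul_assoc, seg_mul_e le_rfl (by omega)]
      simp only [mul_assoc]
      rw [← mul_assoc (e n) (e n), e_mul_e]
    rw [h]
    exact mul_mem (e_mul_sm_two_mul_e_mem hn) (e_mul_seg_mem le_rfl (by omega))

theorem e_mul_cosetRep_mul_e_mem (hn : 4 ≤ n) {p q : ℕ} (hpq : p ≤ q) (hq : q + 2 ≤ n) :
    e n * cosetRep n p q * e n ∈ localGen n := by
  rcases p with _ | _ | p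
  · simpa [cosetRep, seg_zero] using e_mul_seg_two_mul_e_mem hn hq
  · have h : e n * cosetRep n 1 q * e n = e n * seg n 2 q * e n := by
      rw [cosetRep, seg_succ, seg_zero, one_mul, mul_assoc, mul_assoc, mul_assoc]
      exact congrArg (e n * ·) (congrArg (seg n 2 q * ·) sm_one_mul_e)
    simpa only [zero_add, h] using e_mul_seg_two_mul_e_mem hn hq
  · obtain ⟨q, rfl⟩ : ∃ q', q = q' + 2 := ⟨q - 2, by omega⟩
    have h1 := sm_mul_seg_comm (n := n) (k := 1) (a := 4) (l := q) le_rfl (by omega) (by omega)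
    have h2 := sm_mul_seg_comm (n := n) (k := 2) (a := 4) (l := q) (by omega) le_rfl (by omega)
    have hc : cosetRep n (p + 2) (q + 2) = σm n * seg n 4 q * seg n 3 p := by
      rw [cosetRep, seg_succ', seg_succ', seg_succ', seg_succ', σm_eq]
      simp only [mul_assoc, Nat.reduceAdd]
      rw [← mul_assoc (seg n 4 q) (sm n 1), ← h1, mul_assoc, ← mul_assoc (seg n 4 q) (sm n 2), ← h2,
        mul_assoc]
    have h : e n * cosetRep n (p + 2) (q + 2) * e n =
        e n * σm n * e n * (e n * seg n 4 q) * (e n * seg n 3 p) := by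
      have h4 := seg_mul_e (n := n) (a := 4) (l := q) (by omega) (by omega)
      have h3 := seg_mul_e (n := n) (a := 3) (l := p) le_rfl (by omega)
      have hl : e n * seg n 4 q * (e n * seg n 3 p) = seg n 4 q * seg n 3 p * e n := by
        rw [← h4, mul_assoc, ← mul_assoc (e n) (e n), e_mul_e, ← h3, mul_assoc]
      rw [mul_assoc (e n * σm n * e n), hl, hc]
      have he : e n * (seg n 4 q * seg n 3 p * e n) = seg n 4 q * seg n 3 p * e n := by
        rw [← hl, ← mul_assoc, ← mul_assoc (e n) (e n), e_mul_e]
      rw [mul_assoc (e n * σm n), he]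
      simp only [mul_assoc]
    rw [h]
    exact mul_mem (mul_mem (e_mul_σm_mul_e_mem hn) (e_mul_seg_mem (by omega) (by omega)))
      (e_mul_seg_mem le_rfl (by omega))

/-- Right multiplication by a generator `s_k` permutes the cosets of `⟨s₁, s₃, …, s_{n-1}⟩`. -/
theorem cosetRep_mul_sm {p q k : ℕ} (hpq : p ≤ q) (hq : q + 2 ≤ n) (hk : 1 ≤ k) (hkn : k < n) :
    ∃ p' q', p' ≤ q' ∧ q' + 2 ≤ n ∧
      (cosetRep n p q * sm n k = cosetRep n p' q' ∨
        ∃ i, i ≠ 2 ∧ 1 ≤ i ∧ i < n ∧ cosetRep n p q * sm n k = sm n i * cosetRep n p' q') := by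
  have shift : ∀ {i : ℕ}, seg n 2 q * sm n k = sm n i * seg n 2 q →
      seg n 1 p * sm n k = sm n k * seg n 1 p →
      cosetRep n p q * sm n k = sm n i * cosetRep n p q := fun hi hc => by
    rw [cosetRep, mul_assoc, hc, ← mul_assoc, hi, mul_assoc]
  rcases lt_or_ge k p with h | h
  · refine ⟨p, q, hpq, hq, Or.inr ⟨k + 2, by omega, by omega, by omega, ?_⟩⟩
    rw [cosetRep, mul_assoc, seg_mul_sm_shift le_rfl hk (by omega) (by omega), ← mul_assoc,
      seg_mul_sm_shift (by omega) (by omega) (by omega) (by omega), mul_assoc]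
  rcases h.eq_or_lt with rfl | h
  · obtain ⟨p, rfl⟩ : ∃ p', p = 1 + p' := ⟨p - 1, by omega⟩
    refine ⟨p, q, by omega, hq, Or.inl ?_⟩
    rw [cosetRep, mul_assoc, show seg n 1 (1 + p) = seg n 1 (p + 1) by rw [add_comm],
      seg_succ_mul_sm le_rfl (by omega), cosetRep]
  rcases (by omega : k = p + 1 ∨ p + 2 ≤ k) with rfl | h'
  · rcases hpq.eq_or_lt with rfl | hlt
    · refine ⟨p, p, le_rfl, hq, Or.inr ⟨1, by omega, le_rfl, by omega, ?_⟩⟩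
      rw [cosetRep, mul_assoc, add_comm p 1, ← seg_succ, seg_two_mul_seg_one le_rfl hq, seg_succ',
        mul_assoc]
    · refine ⟨p + 1, q, hlt, hq, Or.inl ?_⟩
      rw [cosetRep, mul_assoc, add_comm p 1, ← seg_succ, add_comm 1 p, cosetRep]
  have hc : seg n 1 p * sm n k = sm n k * seg n 1 p := seg_mul_sm_comm le_rfl (by omega) hkn
  rcases lt_or_ge k (q + 1) with hkq | hkq
  · exact ⟨p, q, hpq, hq, Or.inr ⟨k + 1, by omega, by omega, by omega,
      shift (seg_mul_sm_shift (by omega) (by omega) (by omega) (by omega)) hc⟩⟩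
  rcases hkq.eq_or_lt with rfl | hkq
  · obtain ⟨q, rfl⟩ : ∃ q', q = q' + 1 := ⟨q - 1, by omega⟩
    refine ⟨p, q, by omega, by omega, Or.inl ?_⟩
    rw [cosetRep, mul_assoc, hc, ← mul_assoc, (by omega : q + 1 + 1 = 2 + q),
      seg_succ_mul_sm (by omega) (by omega), cosetRep]
  rcases (by omega : k = q + 2 ∨ q + 3 ≤ k) with rfl | hk3
  · refine ⟨p, q + 1, by omega, by omega, Or.inl ?_⟩
    rw [cosetRep, mul_assoc, hc, ← mul_assoc, add_comm q 2, ← seg_succ, cosetRep]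
  · exact ⟨p, q, hpq, hq, Or.inr ⟨k, by omega, by omega, hkn,
      shift (seg_mul_sm_comm (by omega) (by omega) hkn) hc⟩⟩

theorem exists_mul_mk_eq_cosetRep (hn : 4 ≤ n) (w : FreeMonoid (Fin n)) :
    ∀ m : M n, (∃ t ∈ localGen n, ∃ p q, p ≤ q ∧ q + 2 ≤ n ∧ m = t * e n * cosetRep n p q) →
      ∃ t ∈ localGen n, ∃ p q, p ≤ q ∧ q + 2 ≤ n ∧
        m * (Mcon n).mk' w = t * e n * cosetRep n p q := by
  induction w using FreeMonoid.inductionOn' with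
  | one => simp
  | of_mul i w ih =>
    rintro m ⟨t, ht, p, q, hpq, hq, rfl⟩
    rw [map_mul, ← mul_assoc]
    apply ih
    obtain ⟨k, hk⟩ := i
    rcases Nat.eq_zero_or_pos k with rfl | hk1
    · have hx : (Mcon n).mk' (FreeMonoid.of ⟨0, hk⟩) = xm n := by rw [xm, xw, dif_pos]
      refine ⟨t * (e n * cosetRep n p q * e n) * xm n,
        mul_mem (mul_mem ht (e_mul_cosetRep_mul_e_mem hn hpq hq)) xm_mem, 0, 0, le_rfl,
        by omega, ?_⟩
      have h1 : cosetRep n 0 0 = 1 := mul_one 1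
      rw [hx, h1, mul_one, mul_assoc _ (xm n), xm_mul_e,
        ← mul_assoc t, mul_assoc _ (e n) (xm n), e_mul_xm, ← mul_assoc]
    · have hs : (Mcon n).mk' (FreeMonoid.of ⟨k, hk⟩) = sm n k := by rw [sm, sw, dif_pos]
      obtain ⟨p', q', hpq', hq', h | ⟨i, hi2, hi1, hin, h⟩⟩ := cosetRep_mul_sm hpq hq hk1 hk
      · exact ⟨t, ht, p', q', hpq', hq', by rw [hs, mul_assoc, h]⟩
      · rw [hs, mul_assoc, h]
        rcases (by omega : i = 1 ∨ 3 ≤ i) with rfl | hi3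
        · exact ⟨t, ht, p', q', hpq', hq', by
            rw [← mul_assoc, mul_assoc t, e_mul_sm_one]⟩
        · refine ⟨t * (e n * sm n i), mul_mem ht (e_mul_sm_mem hi3 hin), p', q', hpq', hq', ?_⟩
          rw [mul_assoc t (e n * sm n i), mul_assoc (e n) (sm n i), sm_mul_e hi3 hin,
            ← mul_assoc (e n) (e n), e_mul_e]
          simp only [mul_assoc]

theorem e_mul_mul_e_mem (hn : 4 ≤ n) (m : M n) : e n * m * e n ∈ localGen n := by
  obtain ⟨w, rfl⟩ := Con.mk'_surjective m
  obtain ⟨t, ht, p, q, hpq, hq, h⟩ := exists_mul_mk_eq_cosetRep hn w (e n)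
    ⟨1, one_mem _, 0, 0, le_rfl, by omega, by simp [cosetRep, seg_zero]⟩
  rw [h, mul_assoc t, mul_assoc t]
  exact mul_mem ht (e_mul_cosetRep_mul_e_mem hn hpq hq)

end M

/-- For `n ≥ 4`, with `e = x² ∈ Mₙ`, `σ = s₂ s₃ s₁ s₂`,
`X = s₃ x σ x s₃`, `S₁ = x`, and `Sⱼ = x² s_{j+1}` for `2 ≤ j ≤ n - 2`, every element
of the local submonoid `e Mₙ e = {m : e m = m = m e}` is a product of elements of
`{X, S₁, …, S_{n-2}}`, the empty product being interpreted as `e`. -/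
theorem stmt13 (n : ℕ) (hn : 4 ≤ n) (m : M n)
    (hm : xm n ^ 2 * m = m ∧ m * xm n ^ 2 = m) :
    ∃ L : List (M n),
      (∀ a ∈ L,
        a = sm n 3 * xm n * σm n * xm n * sm n 3 ∨
        a = xm n ∨
        ∃ j : ℕ, 2 ≤ j ∧ j ≤ n - 2 ∧ a = xm n ^ 2 * sm n (j + 1)) ∧
      m = (if L.isEmpty then xm n ^ 2 else L.prod) := by
  have hmem : m ∈ M.localGen n := by
    have h := M.e_mul_mul_e_mem hn m
    rwa [← M.e_eq, hm.1, hm.2] at h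
  obtain ⟨L, hL, rfl⟩ := Submonoid.exists_list_of_mem_closure hmem
  refine ⟨L, hL, ?_⟩
  split_ifs with h
  · rw [List.isEmpty_iff] at h
    subst h
    simpa using hm.1.symm
  · rfl
end

section
/- For n ≥ 4, with e = x² ∈ M_n, σ = s_2 s_3 s_1 s_2, X = s_3 x σ x s_3, S_1 = x, and S_j = x² s_{j+1} for 2 ≤ j ≤ n−2, the assignment x ↦ X, s_i ↦ S_i (1 ≤ i ≤ n−2) satisfies all the defining relations of M_{n−1} in the local submonoid e M_n e (a monoid with identity e); consequently there is a monoid homomorphism Ψ : M_{n−1} → e M_n e sending the identity to e, x to X, and s_i to S_i for each 1 ≤ i ≤ n−2. -/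
/-! The computations take place in the monoid of self-maps of a type, so that words in the
generators are iterated applications and no reassociation is needed; a monoid acts faithfully
on itself by left multiplication. -/

section Maps

variable {α : Type*}

/-- The composite `b c a b`, which exchanges `a` and `c`. -/
def swapMap (a b c : α → α) (z : α) : α := b (c (a (b z)))

/-- The composite `c x σ x c`, where `σ = b c a b`. -/
def blockMap (x a b c : α → α) (z : α) : α := c (x (swapMap a b c (x (c z))))

/-- The composite `x b x`. -/
def mergeThree (x b : α → α) (z : α) : α := x (b (x z))

/-- The composite `x b c b x`. -/
def mergePairs (x b c : α → α) (z : α) : α := x (b (c (b (x z))))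

/-- The defining relations of `M 4` for the self-maps `x, a, b, c`. -/
structure FourRelations (x a b c : α → α) : Prop where
  aa z : a (a z) = z
  bb z : b (b z) = z
  cc z : c (c z) = z
  aba z : a (b (a z)) = b (a (b z))
  bcb z : b (c (b z)) = c (b (c z))
  ac z : a (c z) = c (a z)
  xxx z : x (x (x z)) = x z
  xa z : x (a z) = x z
  ax z : a (x z) = x z
  xbxb z : x (b (x (b z))) = x (b (x z))
  bxbx z : b (x (b (x z))) = x (b (x z))
  xbxx z : x (b (x (x z))) = x (b (x z))
  xxbx z : x (x (b (x z))) = x (b (x z))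
  xcx z : x (c (x z)) = c (x (c z))
  sq_swap z : x (x (swapMap a b c (x (x (swapMap a b c z))))) = mergePairs x b c z
  swap_sq z : swapMap a b c (x (x (swapMap a b c (x (x z))))) = mergePairs x b c z

namespace FourRelations

variable {x a b c : α → α}

theorem sq_comm (h : FourRelations x a b c) (z : α) : x (x (c z)) = c (x (x z)) := by
  rw [← h.cc (x (c z)), ← h.xcx, h.xcx, h.cc]

theorem swap_swap (h : FourRelations x a b c) (z : α) :
    swapMap a b c (swapMap a b c z) = z := by
  simp only [swapMap, h.bb, h.ac, h.aa, h.cc]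

theorem swap_c (h : FourRelations x a b c) (z : α) :
    swapMap a b c (c z) = a (swapMap a b c z) := by
  simp only [swapMap]
  rw [← h.ac, ← h.bcb, ← h.aba, h.ac]

theorem c_swap (h : FourRelations x a b c) (z : α) :
    c (swapMap a b c z) = swapMap a b c (a z) := by
  simp only [swapMap]
  rw [← h.bcb, ← h.aba]

theorem mergeThree_sq (h : FourRelations x a b c) (z : α) :
    mergeThree x b (x (x z)) = mergeThree x b z := by
  simp only [mergeThree, h.xxx]

theorem mergePairs_c (h : FourRelations x a b c) (z : α) :
    mergePairs x b c (c z) = mergePairs x b c z := by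
  rw [← h.sq_swap, h.swap_c, h.xa, h.sq_swap]

theorem c_mergePairs (h : FourRelations x a b c) (z : α) :
    c (mergePairs x b c z) = mergePairs x b c z := by
  rw [← h.swap_sq, h.c_swap, h.ax]

theorem mergePairs_eq (h : FourRelations x a b c) (z : α) :
    mergePairs x b c z = x (c (b (c (x z)))) := by
  rw [mergePairs, h.bcb]

theorem x_swap_sq (h : FourRelations x a b c) (z : α) :
    x (swapMap a b c (x (x z))) = x (mergePairs x b c (swapMap a b c z)) := by
  rw [← h.sq_swap, h.swap_swap, h.xxx]

theorem sq_swap_x (h : FourRelations x a b c) (z : α) :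
    x (x (swapMap a b c (x z))) = swapMap a b c (mergePairs x b c (x z)) := by
  rw [← h.swap_sq, h.swap_swap, h.xxx]

theorem blockMap_blockMap (h : FourRelations x a b c) (z : α) :
    blockMap x a b c (blockMap x a b c z) = mergeThree x b z := by
  rw [blockMap, blockMap, h.cc, h.x_swap_sq, h.swap_swap, h.mergePairs_eq]
  simp only [h.sq_comm, h.cc, h.xxbx, h.xbxx, mergeThree]

theorem blockMap_x (h : FourRelations x a b c) (z : α) :
    blockMap x a b c (x z) = blockMap x a b c z := by
  rw [blockMap, h.xcx, h.swap_c, h.xa, blockMap]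

theorem x_blockMap (h : FourRelations x a b c) (z : α) :
    x (blockMap x a b c z) = blockMap x a b c z := by
  rw [blockMap, h.xcx, h.c_swap, h.ax]

theorem mergeThree_blockMap (h : FourRelations x a b c) (z : α) :
    mergeThree x b (blockMap x a b c z) = blockMap x a b c z := by
  rw [← h.blockMap_blockMap]
  simp only [blockMap, h.cc]
  rw [h.swap_sq, ← h.sq_swap, h.swap_swap, h.xxx, h.xxx]

theorem blockMap_mergeThree (h : FourRelations x a b c) (z : α) :
    blockMap x a b c (mergeThree x b z) = blockMap x a b c z := by
  rw [← h.blockMap_blockMap, h.blockMap_blockMap, h.mergeThree_blockMap]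

theorem mergeThree_mergePairs (h : FourRelations x a b c) (z : α) :
    mergeThree x b (mergePairs x b c z) = mergeThree x b (c (mergeThree x b z)) := by
  simp only [mergeThree, mergePairs, h.xbxx, h.xbxb]
  rw [← h.xxbx z, ← h.sq_comm, h.xbxx, h.xbxx]

theorem mergePairs_mergeThree (h : FourRelations x a b c) (z : α) :
    mergePairs x b c (mergeThree x b z) = mergeThree x b (c (mergeThree x b z)) := by
  simp only [mergeThree, mergePairs, h.xxbx, h.bxbx]
  rw [← h.xxbx z, ← h.sq_comm, h.xxx, h.xbxx]

theorem mergeThree_c_mergeThree_c (h : FourRelations x a b c) (z : α) :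
    mergeThree x b (c (mergeThree x b (c z))) = mergeThree x b (c (mergeThree x b z)) := by
  rw [← h.mergeThree_mergePairs, h.mergePairs_c, h.mergeThree_mergePairs]

theorem c_mergeThree_c_mergeThree (h : FourRelations x a b c) (z : α) :
    c (mergeThree x b (c (mergeThree x b z))) = mergeThree x b (c (mergeThree x b z)) := by
  rw [← h.mergePairs_mergeThree, h.c_mergePairs]

theorem blockMap_mergeThree_c_mergeThree (h : FourRelations x a b c) (z : α) :
    blockMap x a b c (mergeThree x b (c (mergeThree x b z))) =
      mergeThree x b (c (mergeThree x b z)) := by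
  have hx w : x (mergeThree x b w) = mergeThree x b w := h.xxbx w
  have hb w : b (mergeThree x b w) = mergeThree x b w := h.bxbx w
  have ha w : a (mergeThree x b w) = mergeThree x b w := h.ax _
  simp only [blockMap, swapMap, h.c_mergeThree_c_mergeThree, hx, hb, ha]

theorem mergeThree_c_mergeThree_blockMap (h : FourRelations x a b c) (z : α) :
    mergeThree x b (c (mergeThree x b (blockMap x a b c z))) =
      mergeThree x b (c (mergeThree x b z)) := by
  have hx w : mergeThree x b (x w) = mergeThree x b w := h.xbxx w
  have hb w : mergeThree x b (b w) = mergeThree x b w := h.xbxb w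
  have ha w : mergeThree x b (a w) = mergeThree x b w := by rw [mergeThree, h.xa, mergeThree]
  simp only [blockMap, swapMap, h.mergeThree_c_mergeThree_c, hx, hb, ha]

theorem blockMap_c_blockMap (h : FourRelations x a b c) (z : α) :
    blockMap x a b c (c (blockMap x a b c z)) = mergeThree x b (c (mergeThree x b z)) := by
  rw [← h.blockMap_mergeThree, ← h.mergeThree_blockMap z, h.mergeThree_c_mergeThree_blockMap,
    h.blockMap_mergeThree_c_mergeThree]

end FourRelations

/-- The defining relations of `M 5` for the self-maps `x, a, b, c, d`, except for the last
relation of type (R6). -/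
structure FiveRelations (x a b c d : α → α) : Prop extends FourRelations x a b c where
  dd z : d (d z) = z
  cdc z : c (d (c z)) = d (c (d z))
  ad z : a (d z) = d (a z)
  bd z : b (d z) = d (b z)
  xd z : x (d z) = d (x z)

/-- The conjugate of `mergePairs x b c` by `c d`. -/
def mergeFar (x b c d : α → α) (z : α) : α := c (d (mergePairs x b c (d (c z))))

/-- The conjugate of `x x` by `c d b c a b`. -/
def mergeLast (x a b c d : α → α) (z : α) : α :=
  c (d (swapMap a b c (x (x (swapMap a b c (d (c z)))))))

namespace FiveRelations

variable {x a b c d : α → α}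

theorem b_mergeLast (h : FiveRelations x a b c d) (z : α) :
    b (mergeLast x a b c d z) = mergeLast x a b c d (b z) := by
  have left w : b (c (d (swapMap a b c w))) = c (d (swapMap a b c (d w))) := by
    simp only [swapMap]
    rw [← h.bd, h.bcb, h.cdc, h.bd, ← h.ad, ← h.bd w]
  have right w : swapMap a b c (d (c (b w))) = d (swapMap a b c (d (c w))) := by
    simp only [swapMap]
    rw [h.bd, h.bcb, ← h.ac, h.cdc, h.ad, h.bd, h.ac, ← h.bd (c w)]
  rw [mergeLast, left, ← h.xd, ← h.xd, ← right, mergeLast]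

theorem mergeFar_eq_sq_mergeLast (h : FiveRelations x a b c d) (z : α) :
    mergeFar x b c d z = x (x (mergeLast x a b c d z)) := by
  simp only [mergeFar, mergeLast, ← h.sq_swap, h.sq_comm, h.xd]

theorem mergeFar_eq_mergeLast_sq (h : FiveRelations x a b c d) (z : α) :
    mergeFar x b c d z = mergeLast x a b c d (x (x z)) := by
  simp only [mergeFar, mergeLast, ← h.swap_sq, ← h.sq_comm, ← h.xd]

theorem mergeThree_mergeFar (h : FiveRelations x a b c d) (z : α) :
    mergeThree x b (mergeFar x b c d z) = mergeFar x b c d (mergeThree x b z) := by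
  have hm w := (h.mergeFar_eq_sq_mergeLast w).symm.trans (h.mergeFar_eq_mergeLast_sq w)
  have hf w : mergeThree x b w = x (x (b (x (x w)))) := by
    rw [h.xxbx, h.xbxx, mergeThree]
  rw [h.mergeFar_eq_mergeLast_sq (mergeThree x b z), h.mergeFar_eq_sq_mergeLast, h.mergeThree_sq,
    hf, hm, h.b_mergeLast, hm, hf, h.xxx]

theorem blockMap_braid_blockMap (h : FiveRelations x a b c d) (z : α) :
    blockMap x a b c (c (d (c (blockMap x a b c z)))) =
      mergeThree x b (mergeFar x b c d z) := by
  have conj w : swapMap a b c (d (swapMap a b c w)) = b (c (d (c (b w)))) := by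
    simp only [swapMap, h.bd, h.bb, h.ad, h.ac, h.aa]
  have conj' w : x (b (c (d (c (b (x w)))))) = d (mergePairs x b c (d w)) := by
    rw [h.cdc, h.bd, ← h.bd (x w), h.xd, ← h.xd w, mergePairs]
  calc blockMap x a b c (c (d (c (blockMap x a b c z))))
      = c (x (swapMap a b c (x (x (d (x (x (swapMap a b c (x (c z)))))))))) := by
        simp only [blockMap, h.cc]
        rw [← h.xd, ← h.xd, h.xxx, h.xd]
    _ = x (x (b (mergeFar x b c d (b (x (x z)))))) := by
        rw [h.x_swap_sq, h.sq_swap_x]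
        simp only [h.mergePairs_eq]
        rw [conj, conj']
        simp only [h.sq_comm, h.cc, mergeFar]
    _ = mergeThree x b (mergeFar x b c d z) := by
        rw [h.mergeFar_eq_sq_mergeLast, ← h.b_mergeLast, h.xxbx, h.xbxx, h.xbxb,
          h.mergeFar_eq_mergeLast_sq, mergeThree]

theorem mergeThree_conj (h : FiveRelations x a b c d) (z : α) :
    x (x (c (d (x (c (mergeThree x b (x (x (c (d (x (c z)))))))))))) = mergeFar x b c d z := by
  rw [h.mergeThree_sq, mergeThree, h.xcx, ← h.xd (c z), h.xcx, ← h.mergePairs_eq, h.c_mergePairs,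
    h.mergePairs_c, h.sq_comm, h.xd, h.xd, mergePairs, h.xxx, mergeFar, mergePairs]

end FiveRelations

end Maps

section Presentation

variable {n : ℕ}

theorem mk_eq_mk_of_rel {u v : FreeMonoid (Fin n)} (h : MRel n u v) :
    (Mcon n).mk' u = (Mcon n).mk' v :=
  (Con.eq _).2 (ConGen.Rel.of _ _ h)

theorem mk_xw : (Mcon n).mk' (xw n) = xm n := rfl

theorem mk_sw (i : ℕ) : (Mcon n).mk' (sw n i) = sm n i := rfl

theorem sm_mul_sm_pow {i j : ℕ} (hi : 1 ≤ i) (hij : i ≤ j) (hj : j ≤ n - 1) :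
    (sm n i * sm n j) ^ mExp i j = 1 := by
  simpa only [mk_sw, map_pow, map_mul, map_one] using mk_eq_mk_of_rel (MRel.r1 hi hij hj)

theorem sm_mul_self {i : ℕ} (hi : 1 ≤ i) (hj : i ≤ n - 1) : sm n i * sm n i = 1 := by
  simpa [mExp] using sm_mul_sm_pow hi le_rfl hj

theorem sm_comm {i j : ℕ} (hi : 1 ≤ i) (hij : i + 2 ≤ j) (hj : j ≤ n - 1) :
    sm n i * sm n j = sm n j * sm n i := by
  have h := sm_mul_sm_pow hi (by omega : i ≤ j) hj
  rw [mExp, if_neg (by omega), if_neg (by omega), pow_two] at h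
  calc sm n i * sm n j = sm n i * sm n j * (sm n i * (sm n j * sm n j) * sm n i) := by
        rw [sm_mul_self (by omega) hj, mul_one, sm_mul_self hi (by omega), mul_one]
    _ = sm n i * sm n j * (sm n i * sm n j) * (sm n j * sm n i) := by simp only [mul_assoc]
    _ = sm n j * sm n i := by rw [h, one_mul]

theorem sm_braid {i : ℕ} (hi : 1 ≤ i) (hj : i + 1 ≤ n - 1) :
    sm n i * sm n (i + 1) * sm n i = sm n (i + 1) * sm n i * sm n (i + 1) := by
  have h := sm_mul_sm_pow hi (by omega : i ≤ i + 1) hj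
  rw [mExp, if_neg (by omega), if_pos (by omega), pow_three] at h
  have hi' := sm_mul_self hi (by omega : i ≤ n - 1)
  have hj' := sm_mul_self (by omega) hj
  generalize sm n i = a at *
  generalize sm n (i + 1) = b at *
  calc a * b * a = a * b * (a * (b * (a * a) * b)) := by rw [hi', mul_one, hj', mul_one]
    _ = a * b * (a * b * (a * (b * b) * a * b)) := by rw [hj', mul_one]; simp only [mul_assoc]
    _ = (a * b * (a * b * (a * b))) * (b * a * b) := by simp only [mul_assoc]
    _ = b * a * b := by rw [h, one_mul]

theorem xm_mul_sm_comm {i : ℕ} (hi : 4 ≤ i) (hj : i ≤ n - 1) :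
    xm n * sm n i = sm n i * xm n := by
  simpa only [mk_xw, mk_sw, map_mul] using mk_eq_mk_of_rel (MRel.r7 hi hj)

theorem σm_eq : σm n = sm n 2 * sm n 3 * sm n 1 * sm n 2 := rfl

theorem fourRelations_left_mul (hn : 4 ≤ n) :
    FourRelations (xm n * ·) (sm n 1 * ·) (sm n 2 * ·) (sm n 3 * ·) where
  aa z := by rw [← mul_assoc, sm_mul_self le_rfl (by omega), one_mul]
  bb z := by rw [← mul_assoc, sm_mul_self (by omega) (by omega), one_mul]
  cc z := by rw [← mul_assoc, sm_mul_self (by omega) (by omega), one_mul]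
  aba z := by
    simpa only [mul_assoc] using congrArg (· * z) (sm_braid (n := n) le_rfl (by omega))
  bcb z := by
    simpa only [mul_assoc] using congrArg (· * z) (sm_braid (n := n) one_le_two (by omega))
  ac z := by
    simpa only [mul_assoc] using
      congrArg (· * z) (sm_comm (n := n) (j := 3) le_rfl le_rfl (by omega))
  xxx z := by
    simpa only [mk_xw, mk_sw, map_mul, map_pow, pow_three, mul_assoc] using
      congrArg (· * z) (mk_eq_mk_of_rel (MRel.r2 (n := n)))
  xa z := by
    simpa only [mk_xw, mk_sw, map_mul, mul_assoc] using
      congrArg (· * z) (mk_eq_mk_of_rel (MRel.r3a (n := n)))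
  ax z := by
    simpa only [mk_xw, mk_sw, map_mul, mul_assoc] using
      congrArg (· * z) (mk_eq_mk_of_rel (MRel.r3b (n := n)))
  xbxb z := by
    simpa only [mk_xw, mk_sw, map_mul, mul_assoc] using
      congrArg (· * z) (mk_eq_mk_of_rel (MRel.r4a (n := n))).symm
  bxbx z := by
    simpa only [mk_xw, mk_sw, map_mul, mul_assoc] using
      congrArg (· * z) (mk_eq_mk_of_rel (MRel.r4b (n := n))).symm
  xbxx z := by
    simpa only [mk_xw, mk_sw, map_mul, map_pow, pow_two, mul_assoc] using
      congrArg (· * z) (mk_eq_mk_of_rel (MRel.r4c (n := n))).symm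
  xxbx z := by
    simpa only [mk_xw, mk_sw, map_mul, map_pow, pow_two, mul_assoc] using
      congrArg (· * z) (mk_eq_mk_of_rel (MRel.r4d (n := n))).symm
  xcx z := by
    simpa only [mk_xw, mk_sw, map_mul, yw, mul_assoc] using
      congrArg (· * z) (mk_eq_mk_of_rel (MRel.r6 (n := n) le_rfl (by omega)))
  sq_swap z := by
    simpa only [mk_xw, mk_sw, map_mul, map_pow, pow_two, mul_assoc, σw, swapMap, mergePairs] using
      congrArg (· * z) (mk_eq_mk_of_rel (MRel.r5b hn))
  swap_sq z := by
    simpa only [mk_xw, mk_sw, map_mul, map_pow, pow_two, mul_assoc, σw, swapMap, mergePairs] using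
      congrArg (· * z)
        ((mk_eq_mk_of_rel (MRel.r5a hn)).symm.trans (mk_eq_mk_of_rel (MRel.r5b hn)))

theorem fiveRelations_left_mul (hn : 5 ≤ n) :
    FiveRelations (xm n * ·) (sm n 1 * ·) (sm n 2 * ·) (sm n 3 * ·) (sm n 4 * ·) where
  toFourRelations := fourRelations_left_mul (by omega)
  dd z := by rw [← mul_assoc, sm_mul_self (by omega) (by omega), one_mul]
  cdc z := by
    simpa only [mul_assoc] using
      congrArg (· * z) (sm_braid (n := n) (i := 3) (by omega) (by omega))
  ad z := by
    simpa only [mul_assoc] using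
      congrArg (· * z) (sm_comm (n := n) (i := 1) (j := 4) (by omega) (by omega) (by omega))
  bd z := by
    simpa only [mul_assoc] using
      congrArg (· * z) (sm_comm (n := n) (i := 2) (j := 4) (by omega) (by omega) (by omega))
  xd z := by
    simpa only [mul_assoc] using
      congrArg (· * z) (xm_mul_sm_comm (n := n) (i := 4) (by omega) (by omega))

/-- The element `X = s₃ x σ x s₃` of `M n`. -/
def blockElem (n : ℕ) : M n := sm n 3 * xm n * σm n * xm n * sm n 3

theorem blockMap_left_mul (z : M n) :
    blockMap (xm n * ·) (sm n 1 * ·) (sm n 2 * ·) (sm n 3 * ·) z = blockElem n * z := by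
  simp only [blockMap, swapMap, blockElem, σm_eq, mul_assoc]

theorem xm_cube (hn : 4 ≤ n) : xm n * xm n * xm n = xm n := by
  simpa [mul_assoc] using (fourRelations_left_mul hn).xxx 1

theorem xm_sq_idem (hn : 4 ≤ n) : IsIdempotentElem (xm n ^ 2) := by
  rw [IsIdempotentElem, pow_two, ← mul_assoc, xm_cube hn]

theorem xm_sq_mul_xm (hn : 4 ≤ n) : xm n ^ 2 * xm n = xm n := by
  rw [pow_two, xm_cube hn]

theorem xm_mul_xm_sq (hn : 4 ≤ n) : xm n * xm n ^ 2 = xm n := by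
  rw [pow_two, ← mul_assoc, xm_cube hn]

theorem xm_sq_commute_sm {i : ℕ} (hi : 3 ≤ i) (hj : i ≤ n - 1) :
    Commute (xm n ^ 2) (sm n i) := by
  obtain rfl | hi := hi.eq_or_lt
  · simpa [pow_two, mul_assoc, Commute, SemiconjBy] using
      (fourRelations_left_mul (by omega)).sq_comm 1
  · exact Commute.pow_left (xm_mul_sm_comm hi hj) 2

theorem blockElem_mul_xm (hn : 4 ≤ n) : blockElem n * xm n = blockElem n := by
  simpa [blockMap_left_mul] using (fourRelations_left_mul hn).blockMap_x 1

theorem xm_mul_blockElem (hn : 4 ≤ n) : xm n * blockElem n = blockElem n := by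
  simpa [blockMap_left_mul] using (fourRelations_left_mul hn).x_blockMap 1

theorem blockElem_mul_xm_sq (hn : 4 ≤ n) : blockElem n * xm n ^ 2 = blockElem n := by
  rw [pow_two, ← mul_assoc, blockElem_mul_xm hn, blockElem_mul_xm hn]

theorem xm_sq_mul_blockElem (hn : 4 ≤ n) : xm n ^ 2 * blockElem n = blockElem n := by
  rw [pow_two, mul_assoc, xm_mul_blockElem hn, xm_mul_blockElem hn]

/-- The image in `M n` of the `i`-th generator of `M (n - 1)`, where `x` has index `0`. -/
def localGen (n i : ℕ) : M n :=
  if i = 0 then blockElem n else if i = 1 then xm n else xm n ^ 2 * sm n (i + 1)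

/-- The multiplicative extension of `localGen` to words. -/
def localLift (n : ℕ) : FreeMonoid (Fin (n - 1)) →* M n :=
  FreeMonoid.lift fun i => localGen n i

theorem localLift_xw (hn : 4 ≤ n) : localLift n (xw (n - 1)) = blockElem n := by
  rw [xw, dif_pos (by omega), localLift, FreeMonoid.lift_eval_of, localGen, if_pos rfl]

theorem localLift_sw_one (hn : 4 ≤ n) : localLift n (sw (n - 1) 1) = xm n := by
  rw [sw, dif_pos (by omega), localLift, FreeMonoid.lift_eval_of, localGen, if_neg (by simp),
    if_pos rfl]

theorem localLift_sw {j : ℕ} (hj : 2 ≤ j) (hjn : j ≤ n - 2) :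
    localLift n (sw (n - 1) j) = xm n ^ 2 * sm n (j + 1) := by
  rw [sw, dif_pos (by omega), localLift, FreeMonoid.lift_eval_of, localGen,
    if_neg (by simp; omega), if_neg (by simp; omega)]

theorem xm_sq_mul_localGen (hn : 4 ≤ n) (i : ℕ) : xm n ^ 2 * localGen n i = localGen n i := by
  unfold localGen
  split_ifs
  · exact xm_sq_mul_blockElem hn
  · exact xm_sq_mul_xm hn
  · rw [← mul_assoc, (xm_sq_idem hn).eq]

theorem localGen_mul_xm_sq (hn : 4 ≤ n) {i : ℕ} (hi : i < n - 1) :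
    localGen n i * xm n ^ 2 = localGen n i := by
  unfold localGen
  split_ifs
  · exact blockElem_mul_xm_sq hn
  · exact xm_mul_xm_sq hn
  · rw [mul_assoc, ← (xm_sq_commute_sm (by omega) (by omega)).eq, ← mul_assoc,
      (xm_sq_idem hn).eq]

theorem xm_sq_commute_localLift (hn : 4 ≤ n) (w : FreeMonoid (Fin (n - 1))) :
    Commute (xm n ^ 2) (localLift n w) := by
  induction w using FreeMonoid.inductionOn' with
  | one => simp
  | of_mul i w ih =>
    rw [map_mul]
    refine Commute.mul_right ?_ ih
    rw [localLift, FreeMonoid.lift_eval_of]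
    exact (xm_sq_mul_localGen hn i).trans (localGen_mul_xm_sq hn i.isLt).symm

theorem localLift_sw_mul_sw_pow (hn : 4 ≤ n) {i j : ℕ} (hi : 1 ≤ i) (hij : i ≤ j)
    (hj : j ≤ n - 2) :
    localLift n ((sw (n - 1) i * sw (n - 1) j) ^ mExp i j) = xm n ^ 2 := by
  have idem := xm_sq_idem hn
  rw [map_pow, map_mul]
  obtain rfl | hi := hi.eq_or_lt
  · rw [localLift_sw_one hn]
    obtain rfl | hj1 := hij.eq_or_lt
    · simp [localLift_sw_one hn, mExp, pow_two]
    rw [localLift_sw hj1 hj, ← mul_assoc, xm_mul_xm_sq hn]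
    obtain rfl | hj2 := Nat.eq_or_lt_of_le hj1
    · have hc := sm_mul_self (n := n) (i := 3) (by omega) (by omega)
      have hx : xm n * sm n 3 * xm n = sm n 3 * xm n * sm n 3 := by
        simpa [mul_assoc] using (fourRelations_left_mul hn).xcx 1
      calc (xm n * sm n 3) ^ 3 = (xm n * sm n 3 * xm n) * sm n 3 * xm n * sm n 3 := by
            simp only [pow_three, mul_assoc]
        _ = sm n 3 * xm n * (sm n 3 * sm n 3) * xm n * sm n 3 := by
            rw [hx]; simp only [mul_assoc]
        _ = sm n 3 * xm n ^ 2 * sm n 3 := by rw [hc, mul_one, pow_two]; simp only [mul_assoc]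
        _ = xm n ^ 2 := by
            rw [← (xm_sq_commute_sm le_rfl (by omega)).eq, mul_assoc, hc, mul_one]
    · rw [mExp, if_neg (by omega), if_neg (by omega),
        Commute.mul_pow (xm_mul_sm_comm (by omega) (by omega)), pow_two (sm n _),
        sm_mul_self (by omega) (by omega), mul_one]
  · have hm : mExp i j = mExp (i + 1) (j + 1) := by
      simp only [mExp, add_left_inj, Nat.add_sub_add_right]
    have comm {k : ℕ} (hk : 2 ≤ k) (hkn : k ≤ n - 2) : Commute (xm n ^ 2) (sm n (k + 1)) :=
      xm_sq_commute_sm (by omega) (by omega)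
    have hpos : mExp i j ≠ 0 := by unfold mExp; split_ifs <;> omega
    rw [localLift_sw hi (by omega), localLift_sw (by omega) hj]
    have hprod : xm n ^ 2 * sm n (i + 1) * (xm n ^ 2 * sm n (j + 1)) =
        xm n ^ 2 * (sm n (i + 1) * sm n (j + 1)) := by
      rw [← mul_assoc, mul_assoc (xm n ^ 2) (sm n (i + 1)), ← (comm hi (by omega)).eq, ← mul_assoc,
        idem.eq, mul_assoc]
    rw [hprod, ((comm hi (by omega)).mul_right (comm (by omega) hj)).mul_pow, hm,
      sm_mul_sm_pow (by omega) (by omega) (by omega), mul_one, ← hm]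
    obtain ⟨k, hk⟩ := Nat.exists_eq_succ_of_ne_zero hpos
    rw [hk, idem.pow_succ_eq]

theorem xm_sq_mul_lm (hn : 4 ≤ n) {i : ℕ} (hi : 2 ≤ i) (hin : i ≤ n - 1) :
    xm n ^ 2 * (Mcon n).mk' (lw n i) = (Mcon n).mk' (lw n i) := by
  induction i, hi using Nat.le_induction with
  | base =>
    change xm n ^ 2 * (xm n * sm n 2 * sm n 1) = xm n * sm n 2 * sm n 1
    simp only [← mul_assoc, xm_sq_mul_xm hn]
  | succ i hi ih =>
    obtain ⟨i, rfl⟩ := Nat.exists_eq_add_of_le' hi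
    change xm n ^ 2 * (sm n (i + 3) * (Mcon n).mk' (lw n (i + 2)) * sm n (i + 3) * sm n (i + 2)) =
      sm n (i + 3) * (Mcon n).mk' (lw n (i + 2)) * sm n (i + 3) * sm n (i + 2)
    simp only [← mul_assoc]
    rw [(xm_sq_commute_sm (by omega) (by omega)).eq, mul_assoc (sm n _), ih (by omega)]

theorem localLift_lw (hn : 4 ≤ n) {i : ℕ} (hi : 2 ≤ i) (hin : i ≤ n - 2) :
    localLift n (lw (n - 1) i) = (Mcon n).mk' (lw n (i + 1)) * xm n ^ 2 := by
  induction i, hi using Nat.le_induction with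
  | base =>
    change localLift n (xw (n - 1) * sw (n - 1) 2 * sw (n - 1) 1) =
      sm n 3 * (xm n * sm n 2 * sm n 1) * sm n 3 * sm n 2 * xm n ^ 2
    rw [map_mul, map_mul, localLift_xw hn, localLift_sw le_rfl hin, localLift_sw_one hn,
      ← mul_assoc, blockElem_mul_xm_sq hn, blockElem, σm_eq, mul_assoc _ (sm n 3) (sm n 3),
      sm_mul_self (by omega) (by omega), mul_one, mul_assoc _ (xm n) (xm n), ← pow_two]
    have hac := sm_comm (n := n) (i := 1) (j := 3) le_rfl le_rfl (by omega)
    rw [mul_assoc (sm n 2), ← hac]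
    simp only [mul_assoc]
  | succ i hi ih =>
    obtain ⟨i, rfl⟩ := Nat.exists_eq_add_of_le' hi
    change localLift n (sw (n - 1) (i + 3) * lw (n - 1) (i + 2) * sw (n - 1) (i + 3) *
      sw (n - 1) (i + 2)) =
      sm n (i + 4) * (Mcon n).mk' (lw n (i + 3)) * sm n (i + 4) * sm n (i + 3) * xm n ^ 2
    have hl := xm_sq_mul_lm hn (i := i + 3) (by omega) (by omega)
    have h3 := xm_sq_commute_sm (n := n) (i := i + 3) (by omega) (by omega)
    have h4 := xm_sq_commute_sm (n := n) (i := i + 4) (by omega) (by omega)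
    have idem := xm_sq_idem hn
    rw [map_mul, map_mul, map_mul, ih (by omega), localLift_sw (by omega) (by omega),
      localLift_sw (by omega) (by omega)]
    change xm n ^ 2 * sm n (i + 4) * ((Mcon n).mk' (lw n (i + 3)) * xm n ^ 2) *
      (xm n ^ 2 * sm n (i + 4)) * (xm n ^ 2 * sm n (i + 3)) = _
    generalize (Mcon n).mk' (lw n (i + 3)) = l at *
    generalize xm n ^ 2 = e at *
    calc e * sm n (i + 4) * (l * e) * (e * sm n (i + 4)) * (e * sm n (i + 3))
        = e * sm n (i + 4) * l * (e * e) * sm n (i + 4) * (e * sm n (i + 3)) := by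
          simp only [mul_assoc]
      _ = sm n (i + 4) * (e * l) * e * sm n (i + 4) * (e * sm n (i + 3)) := by
          rw [idem.eq, h4.eq]
          simp only [mul_assoc]
      _ = sm n (i + 4) * l * sm n (i + 4) * (e * e * sm n (i + 3)) := by
          rw [hl, mul_assoc _ e (sm n (i + 4)), h4.eq]; simp only [mul_assoc]
      _ = sm n (i + 4) * l * sm n (i + 4) * sm n (i + 3) * e := by
          rw [idem.eq, h3.eq]; simp only [mul_assoc]

theorem mk_yw_four (hn : 4 ≤ n) : (Mcon n).mk' (yw n 4) = blockElem n := by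
  change sm n 3 * (xm n * sm n 2 * sm n 1) * sm n 3 * sm n 2 * xm n * sm n 3 = _
  have hac := sm_comm (n := n) (i := 1) (j := 3) le_rfl le_rfl (by omega)
  rw [blockElem, σm_eq, mul_assoc (sm n 2) (sm n 3), ← hac]
  simp only [mul_assoc]

theorem localLift_yw (hn : 4 ≤ n) {i : ℕ} (hi : 3 ≤ i) (hin : i ≤ n - 1) :
    localLift n (yw (n - 1) i) = (Mcon n).mk' (yw n (i + 1)) ∧
      xm n ^ 2 * (Mcon n).mk' (yw n (i + 1)) = (Mcon n).mk' (yw n (i + 1)) ∧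
      (Mcon n).mk' (yw n (i + 1)) * xm n ^ 2 = (Mcon n).mk' (yw n (i + 1)) := by
  induction i, hi using Nat.le_induction with
  | base =>
    rw [mk_yw_four hn]
    exact ⟨localLift_xw hn, xm_sq_mul_blockElem hn, blockElem_mul_xm_sq hn⟩
  | succ i hi ih =>
    obtain ⟨i, rfl⟩ := Nat.exists_eq_add_of_le' hi
    change localLift n (lw (n - 1) (i + 3) * yw (n - 1) (i + 3) * sw (n - 1) (i + 3)) =
      (Mcon n).mk' (lw n (i + 4)) * (Mcon n).mk' (yw n (i + 4)) * sm n (i + 4) ∧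
      xm n ^ 2 * ((Mcon n).mk' (lw n (i + 4)) * (Mcon n).mk' (yw n (i + 4)) * sm n (i + 4)) =
      (Mcon n).mk' (lw n (i + 4)) * (Mcon n).mk' (yw n (i + 4)) * sm n (i + 4) ∧
      (Mcon n).mk' (lw n (i + 4)) * (Mcon n).mk' (yw n (i + 4)) * sm n (i + 4) * xm n ^ 2 =
      (Mcon n).mk' (lw n (i + 4)) * (Mcon n).mk' (yw n (i + 4)) * sm n (i + 4)
    obtain ⟨h1, h2, h3⟩ := ih (by omega)
    have hl := xm_sq_mul_lm hn (i := i + 4) (by omega) (by omega)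
    have hs := xm_sq_commute_sm (n := n) (i := i + 4) (by omega) (by omega)
    refine ⟨?_, ?_, ?_⟩
    · rw [map_mul, map_mul, localLift_lw hn (by omega) (by omega), h1,
        localLift_sw (by omega) (by omega), mul_assoc _ (xm n ^ 2), h2, ← mul_assoc,
        mul_assoc _ _ (xm n ^ 2), h3]
    · simp only [← mul_assoc, hl]
    · rw [mul_assoc, ← hs.eq, ← mul_assoc, mul_assoc _ _ (xm n ^ 2), h3]

theorem blockElem_mul_blockElem (hn : 4 ≤ n) :
    blockElem n * blockElem n = xm n * sm n 2 * xm n := by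
  simpa [blockMap_left_mul, mergeThree, mul_assoc] using
    (fourRelations_left_mul hn).blockMap_blockMap 1

theorem blockElem_cube (hn : 4 ≤ n) : blockElem n ^ 3 = blockElem n := by
  rw [pow_succ, pow_two, blockElem_mul_blockElem hn]
  simpa [blockMap_left_mul, mergeThree, mul_assoc] using
    (fourRelations_left_mul hn).mergeThree_blockMap 1

theorem blockElem_mul_sm_mul_blockElem (hn : 4 ≤ n) :
    blockElem n * sm n 3 * blockElem n =
      xm n * sm n 2 * xm n * sm n 3 * (xm n * sm n 2 * xm n) := by
  simpa [blockMap_left_mul, mergeThree, mul_assoc] using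
    (fourRelations_left_mul hn).blockMap_c_blockMap 1

theorem blockElem_mul_sm_mul_blockElem_mul_sm (hn : 4 ≤ n) :
    blockElem n * sm n 3 * blockElem n * sm n 3 = blockElem n * sm n 3 * blockElem n := by
  rw [blockElem_mul_sm_mul_blockElem hn]
  simpa [mergeThree, mul_assoc] using (fourRelations_left_mul hn).mergeThree_c_mergeThree_c 1

theorem sm_mul_blockElem_mul_sm_mul_blockElem (hn : 4 ≤ n) :
    sm n 3 * (blockElem n * sm n 3 * blockElem n) = blockElem n * sm n 3 * blockElem n := by
  rw [blockElem_mul_sm_mul_blockElem hn]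
  simpa [mergeThree, mul_assoc] using (fourRelations_left_mul hn).c_mergeThree_c_mergeThree 1

theorem blockElem_mul_sm_mul_blockElem_sq (hn : 4 ≤ n) :
    blockElem n * sm n 3 * blockElem n ^ 2 = blockElem n * sm n 3 * blockElem n := by
  rw [pow_two, ← mul_assoc, blockElem_mul_sm_mul_blockElem hn]
  simpa [blockMap_left_mul, mergeThree, mul_assoc] using
    (fourRelations_left_mul hn).mergeThree_c_mergeThree_blockMap 1

theorem blockElem_sq_mul_sm_mul_blockElem (hn : 4 ≤ n) :
    blockElem n ^ 2 * sm n 3 * blockElem n = blockElem n * sm n 3 * blockElem n := by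
  rw [pow_two, mul_assoc, mul_assoc, ← mul_assoc (blockElem n) (sm n 3),
    blockElem_mul_sm_mul_blockElem hn]
  simpa [blockMap_left_mul, mergeThree, mul_assoc] using
    (fourRelations_left_mul hn).blockMap_mergeThree_c_mergeThree 1

theorem blockElem_commute_sm {i : ℕ} (hi : 5 ≤ i) (hin : i ≤ n - 1) :
    Commute (blockElem n) (sm n i) := by
  have hx : Commute (xm n) (sm n i) := xm_mul_sm_comm (by omega) hin
  have hs {j : ℕ} (hj : 1 ≤ j) (hji : j + 2 ≤ i) : Commute (sm n j) (sm n i) :=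
    sm_comm hj hji hin
  have h1 := hs le_rfl (by omega)
  have h2 := hs one_le_two (by omega)
  have h3 := hs (j := 3) (by omega) (by omega)
  have hσ : Commute (σm n) (sm n i) := ((h2.mul_left h3).mul_left h1).mul_left h2
  exact (((h3.mul_left hx).mul_left hσ).mul_left hx).mul_left h3

theorem blockElem_mul_gen (hn : 4 ≤ n) (a : M n) :
    blockElem n * (xm n ^ 2 * a) = blockElem n * a := by
  rw [← mul_assoc, blockElem_mul_xm_sq hn]

theorem gen_mul_blockElem (hn : 4 ≤ n) {i : ℕ} (hi : 3 ≤ i) (hin : i ≤ n - 1) :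
    xm n ^ 2 * sm n i * blockElem n = sm n i * blockElem n := by
  rw [(xm_sq_commute_sm hi hin).eq, mul_assoc, xm_sq_mul_blockElem hn]

theorem localLift_σw (hn : 5 ≤ n) :
    localLift n (σw (n - 1)) =
      xm n * xm n * sm n 3 * sm n 4 * xm n * sm n 3 := by
  have h3 := xm_sq_commute_sm (n := n) (i := 3) (by omega) (by omega)
  rw [σw, map_mul, map_mul, map_mul, localLift_sw (j := 2) le_rfl (by omega),
    localLift_sw (j := 3) (by omega) (by omega), localLift_sw_one (by omega)]
  calc xm n ^ 2 * sm n 3 * (xm n ^ 2 * sm n 4) * xm n * (xm n ^ 2 * sm n 3)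
      = xm n ^ 2 * (sm n 3 * xm n ^ 2) * sm n 4 * (xm n * xm n ^ 2) * sm n 3 := by
        simp only [mul_assoc]
    _ = xm n ^ 2 * xm n ^ 2 * sm n 3 * sm n 4 * xm n * sm n 3 := by
        rw [← h3.eq, xm_mul_xm_sq (by omega)]
        simp only [mul_assoc]
    _ = _ := by rw [(xm_sq_idem (by omega)).eq, pow_two]

theorem localLift_rel_commute (hn : 5 ≤ n) :
    blockElem n ^ 2 * localLift n (σw (n - 1)) * blockElem n ^ 2 * localLift n (σw (n - 1)) =
      localLift n (σw (n - 1)) * blockElem n ^ 2 * localLift n (σw (n - 1)) * blockElem n ^ 2 := by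
  have h := fiveRelations_left_mul hn
  have h1 := h.mergeThree_mergeFar 1
  rw [← h.mergeThree_conj, ← h.mergeThree_conj] at h1
  simpa [localLift_σw hn, pow_two (blockElem n), blockElem_mul_blockElem (by omega : 4 ≤ n),
    mergeThree, mul_assoc] using h1

theorem localLift_rel_merge (hn : 5 ≤ n) :
    blockElem n ^ 2 * localLift n (σw (n - 1)) * blockElem n ^ 2 * localLift n (σw (n - 1)) =
      blockElem n * sm n 3 * sm n 4 * sm n 3 * blockElem n := by
  have h := fiveRelations_left_mul hn
  have h1 := h.blockMap_braid_blockMap 1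
  rw [← h.mergeThree_conj, blockMap_left_mul, blockMap_left_mul] at h1
  simpa [localLift_σw hn, pow_two (blockElem n), blockElem_mul_blockElem (by omega : 4 ≤ n),
    mergeThree, mul_assoc] using h1.symm

theorem localLift_eq_of_rel (hn : 4 ≤ n) {u v : FreeMonoid (Fin (n - 1))}
    (h : MRel (n - 1) u v) : xm n ^ 2 * localLift n u = xm n ^ 2 * localLift n v := by
  have idem := xm_sq_idem hn
  have hS : localLift n (sw (n - 1) 2) = xm n ^ 2 * sm n 3 := localLift_sw le_rfl (by omega)
  have hX := blockElem_mul_gen hn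
  have hX' := gen_mul_blockElem hn (i := 3) le_rfl (by omega)
  cases h with
  | r1 hi hij hj =>
    rw [localLift_sw_mul_sw_pow hn hi hij (by omega), map_one, mul_one, idem.eq]
  | r2 => rw [map_pow, localLift_xw hn, blockElem_cube hn]
  | r3a => rw [map_mul, localLift_xw hn, localLift_sw_one hn, blockElem_mul_xm hn]
  | r3b => rw [map_mul, localLift_xw hn, localLift_sw_one hn, xm_mul_blockElem hn]
  | r4a =>
    simp only [map_mul, localLift_xw hn, hS]
    rw [hX, mul_assoc _ (blockElem n), hX, ← mul_assoc _ (blockElem n),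
      blockElem_mul_sm_mul_blockElem_mul_sm hn]
  | r4b =>
    simp only [map_mul, localLift_xw hn, hS]
    rw [hX, hX', mul_assoc (sm n 3) (blockElem n), hX, mul_assoc (sm n 3),
      sm_mul_blockElem_mul_sm_mul_blockElem hn]
  | r4c =>
    simp only [map_mul, map_pow, localLift_xw hn, hS]
    rw [hX, blockElem_mul_sm_mul_blockElem_sq hn]
  | r4d =>
    simp only [map_mul, map_pow, localLift_xw hn, hS]
    rw [hX, mul_assoc (blockElem n ^ 2), hX', ← mul_assoc (blockElem n ^ 2),
      blockElem_sq_mul_sm_mul_blockElem hn]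
  | r5a h4 =>
    simp only [map_mul, map_pow, localLift_xw hn]
    rw [localLift_rel_commute (by omega)]
  | r5b h4 =>
    have hT : localLift n (sw (n - 1) 3) = xm n ^ 2 * sm n 4 :=
      localLift_sw (by omega) (by omega)
    have hs := xm_sq_commute_sm (n := n) (i := 3) le_rfl (by omega)
    simp only [map_mul, map_pow, localLift_xw hn, hS, hT]
    rw [localLift_rel_merge (by omega), hX, ← mul_assoc (blockElem n * sm n 3),
      mul_assoc (blockElem n) (sm n 3) (xm n ^ 2), ← hs.eq, hX,
      mul_assoc _ (xm n ^ 2 * sm n 3), hX', ← mul_assoc _ (sm n 3) (blockElem n)]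
  | @r6 i hi hin =>
    obtain ⟨hy, hl, hr⟩ := localLift_yw hn hi (by omega)
    have hrel := mk_eq_mk_of_rel (MRel.r6 (n := n) (i := i + 1) (by omega) (by omega))
    simp only [map_mul, mk_sw] at hrel
    simp only [map_mul, hy, localLift_sw (by omega : 2 ≤ i) (by omega : i ≤ n - 2)]
    rw [← mul_assoc _ (xm n ^ 2), hr, hrel, mul_assoc _ _ (xm n ^ 2 * _), ← mul_assoc _ (xm n ^ 2),
      hr, mul_assoc (xm n ^ 2) (sm n (i + 1)), ← mul_assoc (xm n ^ 2) (xm n ^ 2), idem.eq,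
      mul_assoc (sm n (i + 1))]
  | r7 hi hin =>
    rw [map_mul, map_mul, localLift_xw hn, localLift_sw (by omega) (by omega), hX,
      gen_mul_blockElem hn (by omega) (by omega), (blockElem_commute_sm (by omega) (by omega)).eq]

/-- Words identified by `M (n - 1)` have the same image in the local submonoid. -/
theorem localLift_eq_of_mcon (hn : 4 ≤ n) {u v : FreeMonoid (Fin (n - 1))}
    (h : Mcon (n - 1) u v) : xm n ^ 2 * localLift n u = xm n ^ 2 * localLift n v := by
  induction h with
  | of u v h => exact localLift_eq_of_rel hn h
  | refl u => rfl
  | symm _ ih => exact ih.symm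
  | trans _ _ ih₁ ih₂ => exact ih₁.trans ih₂
  | mul _ _ ih₁ ih₂ =>
    rw [map_mul, map_mul, ← mul_assoc, ih₁, (xm_sq_commute_localLift hn _).eq, mul_assoc, ih₂,
      ← mul_assoc, ← (xm_sq_commute_localLift hn _).eq, mul_assoc]

end Presentation

/-- For `n ≥ 4`, with `e = x² ∈ Mₙ`, `σ = s₂ s₃ s₁ s₂`,
`X = s₃ x σ x s₃`, `S₁ = x`, and `Sⱼ = x² s_{j+1}` for `2 ≤ j ≤ n - 2`, the assignment
`x ↦ X`, `sᵢ ↦ Sᵢ` satisfies all defining relations of `M_{n-1}` in the local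
submonoid `e Mₙ e` (a monoid with identity `e`); consequently there is a monoid
homomorphism `Ψ : M_{n-1} → e Mₙ e` sending the identity to `e`, `x` to `X`, and `sᵢ`
to `Sᵢ` for `1 ≤ i ≤ n - 2`.  (The existence of such a multiplicative, identity- and
generator-respecting map with values in `e Mₙ e` is exactly the content of the
relations being satisfied, by the universal property of the presentation.) -/
theorem stmt15 (n : ℕ) (hn : 4 ≤ n) :
    ∃ Ψ : M (n - 1) → M n,
      (∀ a b : M (n - 1), Ψ (a * b) = Ψ a * Ψ b) ∧
      Ψ 1 = xm n ^ 2 ∧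
      (∀ a : M (n - 1), xm n ^ 2 * Ψ a = Ψ a ∧ Ψ a * xm n ^ 2 = Ψ a) ∧
      Ψ (xm (n - 1)) = sm n 3 * xm n * σm n * xm n * sm n 3 ∧
      Ψ (sm (n - 1) 1) = xm n ∧
      (∀ j : ℕ, 2 ≤ j → j ≤ n - 2 → Ψ (sm (n - 1) j) = xm n ^ 2 * sm n (j + 1)) := by
  have idem := xm_sq_idem hn
  have comm := xm_sq_commute_localLift hn
  refine ⟨fun a => Con.liftOn a (fun w => xm n ^ 2 * localLift n w)
    fun _ _ h => localLift_eq_of_mcon hn h, ?_, ?_, ?_, ?_, ?_, ?_⟩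
  · intro a b
    induction a, b using Con.induction_on₂ with | _ u v
    change xm n ^ 2 * localLift n (u * v) =
      xm n ^ 2 * localLift n u * (xm n ^ 2 * localLift n v)
    rw [map_mul, mul_assoc, ← mul_assoc (localLift n u), ← (comm u).eq, ← mul_assoc, ← mul_assoc,
      ← mul_assoc, idem.eq]
  · change xm n ^ 2 * localLift n 1 = xm n ^ 2
    rw [map_one, mul_one]
  · intro a
    induction a using Con.induction_on with | _ w
    change xm n ^ 2 * (xm n ^ 2 * localLift n w) = xm n ^ 2 * localLift n w ∧
      xm n ^ 2 * localLift n w * xm n ^ 2 = xm n ^ 2 * localLift n w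
    rw [mul_assoc, ← (comm w).eq, ← mul_assoc, idem.eq]
    exact ⟨rfl, rfl⟩
  · change xm n ^ 2 * localLift n (xw (n - 1)) = blockElem n
    rw [localLift_xw hn, xm_sq_mul_blockElem hn]
  · change xm n ^ 2 * localLift n (sw (n - 1) 1) = xm n
    rw [localLift_sw_one hn, xm_sq_mul_xm hn]
  · intro j hj hjn
    change xm n ^ 2 * localLift n (sw (n - 1) j) = _
    rw [localLift_sw hj hjn, ← mul_assoc, idem.eq]
end
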